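/- arXiv:1210.3060 — 13 statements merged into one kernel-verified Lean document; each statement's English description precedes it below -/
import Mathlib

section
/- Let (Ω, P) be a probability space and X, Y : Ω → ℝ random variables with X ≥ 0 and Y ≥ 0 almost surely. Let K be a Markov kernel from ℝ to ℝ that is a version of the conditional distribution of X given Y. Assume: (i) t·P(Y > t·y) → 1/y as t → ∞ (t ∈ ℝ) for every y > 0; (ii) there is a Borel probability measure G on ℝ with G([0,∞)) = 1 such that K(t)([0, t·x]) → G([0, x]) as t → ∞ for every x > 0 at which the function x' ↦ G([0, x']) is continuous. Then for all x > 0 and y > 0, t·P(X ≤ t·x, Y > t·y) → (1/x)·∫₀^{x/y} G([0, u]) du as t → ∞. -/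
open MeasureTheory ProbabilityTheory Filter Set

theorem Monotone.mul_le_intervalIntegral_sub {H : ℝ → ℝ} (hH : Monotone H) {a b : ℝ}
    (hab : a ≤ b) : (b - a) * H a ≤ (∫ v in (0:ℝ)..b, H v) - ∫ v in (0:ℝ)..a, H v := by
  rw [intervalIntegral.integral_interval_sub_left hH.intervalIntegrable hH.intervalIntegrable]
  have := intervalIntegral.integral_mono_on (μ := volume) hab (f := fun _ => H a) (g := H)
    intervalIntegrable_const hH.intervalIntegrable (fun v hv => hH hv.1)
  simpa using this

theorem Monotone.intervalIntegral_sub_le_mul {H : ℝ → ℝ} (hH : Monotone H) {a b : ℝ}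
    (hab : a ≤ b) : (∫ v in (0:ℝ)..b, H v) - (∫ v in (0:ℝ)..a, H v) ≤ (b - a) * H b := by
  rw [intervalIntegral.integral_interval_sub_left hH.intervalIntegrable hH.intervalIntegrable]
  have := intervalIntegral.integral_mono_on (μ := volume) hab (f := H) (g := fun _ => H b)
    hH.intervalIntegrable intervalIntegrable_const (fun v hv => hH hv.2)
  simpa using this

theorem Monotone.exists_continuousAt_mem_Ioo {H : ℝ → ℝ} (hH : Monotone H) {a b : ℝ}
    (hab : a < b) : ∃ c ∈ Ioo a b, ContinuousAt H c := by
  obtain ⟨c, hc, hcI⟩ := (hH.countable_not_continuousAt.dense_compl ℝ).exists_between hab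
  exact ⟨c, hcI, by simpa using hc⟩

theorem exists_nat_mesh {w ε : ℝ} (hw : 0 < w) (hε : 0 < ε) :
    ∃ (i : ℕ) (h : ℝ), 0 < h ∧ h < ε ∧ (i + 1) * h = w := by
  obtain ⟨i, hi⟩ := exists_nat_gt (w / ε)
  have hi1 : (0:ℝ) < i + 1 := by positivity
  refine ⟨i, w / (i + 1), by positivity, ?_, by field_simp⟩
  rw [div_lt_iff₀ hε] at hi
  rw [div_lt_iff₀ hi1]
  nlinarith

/-- If the increments of `φ t` over `[w₁, w₂]` are asymptotically at most `(w₂ - w₁) * H v`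
for each `v > w₂`, then `φ t w` is asymptotically at most the integral of `H` over `[0, w]`. -/
theorem eventually_le_intervalIntegral_of_increment_le {H : ℝ → ℝ} (hH : Monotone H)
    (h0 : ∀ u, 0 ≤ H u) (h1 : ∀ u, H u ≤ 1) {φ : ℝ → ℝ → ℝ}
    (hbase : ∀ w, 0 < w → ∀ ε > 0, ∀ᶠ t in atTop, φ t w ≤ w + ε)
    (hinc : ∀ w₁ w₂ v, 0 < w₁ → w₁ < w₂ → w₂ < v → ∀ ε > 0,
      ∀ᶠ t in atTop, φ t w₂ - φ t w₁ ≤ (w₂ - w₁) * H v + ε)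
    {w : ℝ} (hw : 0 < w) {ε : ℝ} (hε : 0 < ε) :
    ∀ᶠ t in atTop, φ t w ≤ (∫ v in (0:ℝ)..w, H v) + ε := by
  have key : ∀ h : ℝ, 0 < h → ∀ i : ℕ, ∀ ε > 0, ∀ᶠ t in atTop,
      φ t ((i + 1) * h) ≤ h + (∫ v in (0:ℝ)..((i + 3) * h), H v) + ε := by
    intro h hh i
    induction i with
    | zero =>
      intro ε hε
      filter_upwards [hbase h hh ε hε] with t ht
      have : 0 ≤ ∫ v in (0:ℝ)..(3 * h), H v :=
        intervalIntegral.integral_nonneg (by positivity) (fun v _ => h0 v)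
      simp only [Nat.cast_zero, zero_add, one_mul]
      linarith
    | succ i ih =>
      intro ε hε
      have hi : (0:ℝ) ≤ i := i.cast_nonneg
      filter_upwards [ih (ε / 2) (by positivity), hinc ((i + 1) * h) ((i + 2) * h)
        ((i + 3) * h) (by positivity) (by nlinarith) (by nlinarith) (ε / 2)
        (by positivity)] with t h3 h4
      have h5 := hH.mul_le_intervalIntegral_sub
        (show ((i:ℝ) + 3) * h ≤ (i + 4) * h by nlinarith)
      have e1 : ((i:ℝ) + 4) * h - (i + 3) * h = h := by ring
      have e2 : ((i:ℝ) + 2) * h - (i + 1) * h = h := by ring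
      have e3 : ((i + 1 : ℕ) + 1 : ℝ) * h = (i + 2) * h := by push_cast; ring
      have e4 : ((i + 1 : ℕ) + 3 : ℝ) * h = (i + 4) * h := by push_cast; ring
      rw [e1] at h5
      rw [e2] at h4
      rw [e3, e4]
      linarith
  obtain ⟨i, h, hh, hhε, hi⟩ := exists_nat_mesh hw (show 0 < ε / 6 by positivity)
  filter_upwards [key h hh i (ε / 2) (by positivity)] with t ht
  have e : ((i:ℝ) + 3) * h = w + 2 * h := by rw [← hi]; ring
  rw [hi, e] at ht
  have h5 := hH.intervalIntegral_sub_le_mul (show w ≤ w + 2 * h by linarith)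
  nlinarith [h1 (w + 2 * h)]

/-- If the increments of `φ t` over `[w₁, w₂]` are asymptotically at least `(w₂ - w₁) * H v`
for each `v < w₁`, then `φ t w` is asymptotically at least the integral of `H` over `[0, w]`. -/
theorem eventually_intervalIntegral_le_of_le_increment {H : ℝ → ℝ} (hH : Monotone H)
    (h0 : ∀ u, 0 ≤ H u) (h1 : ∀ u, H u ≤ 1) {φ : ℝ → ℝ → ℝ}
    (hbase : ∀ w, 0 < w → ∀ᶠ t in atTop, 0 ≤ φ t w)
    (hinc : ∀ w₁ w₂ v, 0 ≤ v → v < w₁ → w₁ < w₂ → ∀ ε > 0,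
      ∀ᶠ t in atTop, (w₂ - w₁) * H v - ε ≤ φ t w₂ - φ t w₁)
    {w : ℝ} (hw : 0 < w) {ε : ℝ} (hε : 0 < ε) :
    ∀ᶠ t in atTop, (∫ v in (0:ℝ)..w, H v) - ε ≤ φ t w := by
  have key : ∀ h : ℝ, 0 < h → ∀ i : ℕ, ∀ ε > 0, ∀ᶠ t in atTop,
      (∫ v in (0:ℝ)..((i - 1) * h), H v) - ε ≤ φ t ((i + 1) * h) := by
    intro h hh i
    induction i with
    | zero =>
      intro ε hε
      filter_upwards [hbase h hh] with t ht
      have h5 := hH.mul_le_intervalIntegral_sub (show -h ≤ 0 by linarith)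
      have h6 : 0 ≤ (0 - -h) * H (-h) := mul_nonneg (by linarith) (h0 _)
      rw [intervalIntegral.integral_same] at h5
      simp only [Nat.cast_zero, zero_add, one_mul, zero_sub, neg_mul]
      linarith
    | succ i ih =>
      intro ε hε
      have hi : (0:ℝ) ≤ i := i.cast_nonneg
      filter_upwards [ih (ε / 2) (by positivity), hinc ((i + 1) * h) ((i + 2) * h)
        (i * h) (by positivity) (by nlinarith) (by nlinarith) (ε / 2)
        (by positivity)] with t h3 h4
      have h5 := hH.intervalIntegral_sub_le_mul
        (show ((i:ℝ) - 1) * h ≤ i * h by nlinarith)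
      have e1 : (i:ℝ) * h - (i - 1) * h = h := by ring
      have e2 : ((i:ℝ) + 2) * h - (i + 1) * h = h := by ring
      have e3 : ((i + 1 : ℕ) + 1 : ℝ) * h = (i + 2) * h := by push_cast; ring
      have e4 : ((i + 1 : ℕ) - 1 : ℝ) * h = i * h := by push_cast; ring
      rw [e1] at h5
      rw [e2] at h4
      rw [e3, e4]
      linarith
  obtain ⟨i, h, hh, hhε, hi⟩ := exists_nat_mesh hw (show 0 < ε / 6 by positivity)
  filter_upwards [key h hh i (ε / 2) (by positivity)] with t ht
  have e : ((i:ℝ) - 1) * h = w - 2 * h := by rw [← hi]; ring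
  rw [hi, e] at ht
  have h5 := hH.intervalIntegral_sub_le_mul (show w - 2 * h ≤ w by linarith)
  nlinarith [h1 w]

theorem monotone_measureReal_Icc (G : Measure ℝ) [IsFiniteMeasure G] (a : ℝ) :
    Monotone fun u : ℝ => (G (Icc a u)).toReal := fun _ _ huv =>
  measureReal_mono (Icc_subset_Icc_right huv)

section Kernel

variable {K : Kernel ℝ ℝ} [IsMarkovKernel K] {G : Measure ℝ} [IsProbabilityMeasure G]

theorem eventually_forall_kernel_Icc_le
    (hKconv : ∀ x : ℝ, 0 < x →
      ContinuousAt (fun x' : ℝ => (G (Icc 0 x')).toReal) x →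
      Tendsto (fun t : ℝ => ((K t) (Icc 0 (t * x))).toReal) atTop
        (nhds ((G (Icc 0 x)).toReal)))
    {x w v : ℝ} (hx : 0 < x) (hw : 0 < w) (hwv : w < v) {ε : ℝ} (hε : 0 < ε) :
    ∀ᶠ t in atTop, ∀ s, t * w⁻¹ < s →
      ((K s) (Icc 0 (t * x))).toReal ≤ (G (Icc 0 (x * v))).toReal + ε := by
  obtain ⟨c, ⟨hc1, hc2⟩, hc⟩ := (monotone_measureReal_Icc G 0).exists_continuousAt_mem_Ioo
    (mul_lt_mul_of_pos_left hwv hx)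
  have hc0 : 0 < c := lt_trans (by positivity) hc1
  obtain ⟨t₀, ht₀⟩ := eventually_atTop.1
    ((hKconv c hc0 hc).eventually (gt_mem_nhds (lt_add_of_pos_right _ hε)))
  filter_upwards [eventually_ge_atTop (t₀ * w), eventually_gt_atTop 0] with t ht htpos s hs
  have h1 : t₀ ≤ t * w⁻¹ := by rw [← div_eq_mul_inv, le_div_iff₀ hw]; exact ht
  have hs0 : 0 < s := lt_trans (by positivity) hs
  have h2 : t ≤ s * w := by rw [← div_eq_mul_inv, div_lt_iff₀ hw] at hs; exact hs.le
  have h3 : t * x ≤ s * c := by nlinarith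
  have h4 := monotone_measureReal_Icc (K s) 0 h3
  have h5 := monotone_measureReal_Icc G 0 hc2.le
  have h6 := ht₀ s (h1.trans hs.le)
  simp only at h4 h5
  linarith

theorem eventually_forall_le_kernel_Icc
    (hKconv : ∀ x : ℝ, 0 < x →
      ContinuousAt (fun x' : ℝ => (G (Icc 0 x')).toReal) x →
      Tendsto (fun t : ℝ => ((K t) (Icc 0 (t * x))).toReal) atTop
        (nhds ((G (Icc 0 x)).toReal)))
    {x w₁ w₂ v : ℝ} (hx : 0 < x) (hv : 0 ≤ v) (hvw : v < w₁) (hw : w₁ < w₂)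
    {ε : ℝ} (hε : 0 < ε) :
    ∀ᶠ t in atTop, ∀ s, t * w₂⁻¹ < s → s ≤ t * w₁⁻¹ →
      (G (Icc 0 (x * v))).toReal - ε ≤ ((K s) (Icc 0 (t * x))).toReal := by
  obtain ⟨c, ⟨hc1, hc2⟩, hc⟩ := (monotone_measureReal_Icc G 0).exists_continuousAt_mem_Ioo
    (mul_lt_mul_of_pos_left hvw hx)
  have hw₁ : 0 < w₁ := hv.trans_lt hvw
  have hw₂ : 0 < w₂ := hw₁.trans hw
  have hc0 : 0 < c := lt_of_le_of_lt (by positivity) hc1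
  obtain ⟨t₀, ht₀⟩ := eventually_atTop.1
    ((hKconv c hc0 hc).eventually (lt_mem_nhds (sub_lt_self _ hε)))
  filter_upwards [eventually_ge_atTop (t₀ * w₂), eventually_gt_atTop 0] with t ht htpos s hs hs'
  have h1 : t₀ ≤ t * w₂⁻¹ := by rw [← div_eq_mul_inv, le_div_iff₀ hw₂]; exact ht
  have hs0 : 0 < s := lt_trans (by positivity) hs
  have h2 : s * w₁ ≤ t := by rwa [← div_eq_mul_inv, le_div_iff₀ hw₁] at hs'
  have h3 : s * c ≤ t * x := by nlinarith
  have h4 := monotone_measureReal_Icc (K s) 0 h3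
  have h5 := monotone_measureReal_Icc G 0 hc1.le
  have h6 := ht₀ s (h1.trans hs.le)
  simp only at h4 h5
  linarith

end Kernel

section Disintegration

variable {Ω : Type*} [MeasurableSpace Ω] {P : Measure Ω} [IsProbabilityMeasure P]
  {X Y : Ω → ℝ} {K : Kernel ℝ ℝ} {A B : Set ℝ} {a : ℝ}

theorem measure_joint_le_mul_of_kernel_le [IsMarkovKernel K] (hY : Measurable Y)
    (hKver : ∀ A B : Set ℝ, MeasurableSet A → MeasurableSet B →
      P {ω | X ω ∈ A ∧ Y ω ∈ B} = ∫⁻ y in B, K y A ∂(P.map Y))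
    (hA : MeasurableSet A) (hB : MeasurableSet B) (ha : 0 ≤ a)
    (h : ∀ s ∈ B, ((K s) A).toReal ≤ a) :
    (P {ω | X ω ∈ A ∧ Y ω ∈ B}).toReal ≤ a * (P (Y ⁻¹' B)).toReal := by
  rw [← ENNReal.toReal_ofReal ha, ← ENNReal.toReal_mul]
  refine ENNReal.toReal_mono (ENNReal.mul_ne_top ENNReal.ofReal_ne_top (measure_ne_top _ _)) ?_
  rw [hKver A B hA hB, ← Measure.map_apply hY hB, ← setLIntegral_const]
  refine setLIntegral_mono measurable_const fun s hs => ?_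
  exact ENNReal.le_ofReal_iff_toReal_le (measure_ne_top _ _) ha |>.2 (h s hs)

theorem mul_le_measure_joint_of_le_kernel (hY : Measurable Y)
    (hKver : ∀ A B : Set ℝ, MeasurableSet A → MeasurableSet B →
      P {ω | X ω ∈ A ∧ Y ω ∈ B} = ∫⁻ y in B, K y A ∂(P.map Y))
    (hA : MeasurableSet A) (hB : MeasurableSet B)
    (h : ∀ s ∈ B, a ≤ ((K s) A).toReal) :
    a * (P (Y ⁻¹' B)).toReal ≤ (P {ω | X ω ∈ A ∧ Y ω ∈ B}).toReal := by
  rcases lt_or_ge a 0 with ha | ha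
  · exact (mul_nonpos_of_nonpos_of_nonneg ha.le ENNReal.toReal_nonneg).trans
      ENNReal.toReal_nonneg
  rw [← ENNReal.toReal_ofReal ha, ← ENNReal.toReal_mul]
  refine ENNReal.toReal_mono (measure_ne_top _ _) ?_
  rw [hKver A B hA hB, ← Measure.map_apply hY hB, ← setLIntegral_const]
  refine setLIntegral_mono (K.measurable_coe hA) fun s hs => ?_
  exact ENNReal.ofReal_le_of_le_toReal (h s hs)

theorem measure_joint_sub_eq (hX : Measurable X) (hY : Measurable Y) (hA : MeasurableSet A)
    {p q : ℝ} (hpq : p ≤ q) :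
    (P {ω | X ω ∈ A ∧ p < Y ω}).toReal - (P {ω | X ω ∈ A ∧ q < Y ω}).toReal =
      (P {ω | X ω ∈ A ∧ Y ω ∈ Ioc p q}).toReal := by
  have hsub : {ω | X ω ∈ A ∧ q < Y ω} ⊆ {ω | X ω ∈ A ∧ p < Y ω} :=
    fun ω hω => ⟨hω.1, hpq.trans_lt hω.2⟩
  have hm : MeasurableSet {ω | X ω ∈ A ∧ q < Y ω} :=
    (hX hA).inter (measurableSet_lt measurable_const hY)
  have := measureReal_sdiff (μ := P) hsub hm
  simp only [measureReal_def] at this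
  rw [← this]
  congr 2
  ext ω
  simp only [Set.mem_sdiff, mem_ofPred_eq, mem_Ioc, not_and, not_lt]
  tauto

theorem tendsto_mul_measure_preimage_Ioc (hY : Measurable Y)
    (hYtail : ∀ y : ℝ, 0 < y →
      Tendsto (fun t : ℝ => t * (P {ω | t * y < Y ω}).toReal) atTop (nhds (1 / y)))
    {w₁ w₂ : ℝ} (hw₁ : 0 < w₁) (hw : w₁ < w₂) :
    Tendsto (fun t : ℝ => t * (P (Y ⁻¹' Ioc (t * w₂⁻¹) (t * w₁⁻¹))).toReal) atTop
      (nhds (w₂ - w₁)) := by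
  have hw₂ := hw₁.trans hw
  have h := (hYtail w₂⁻¹ (inv_pos.2 hw₂)).sub (hYtail w₁⁻¹ (inv_pos.2 hw₁))
  rw [one_div, one_div, inv_inv, inv_inv] at h
  refine h.congr' ?_
  filter_upwards [eventually_gt_atTop 0] with t ht
  have h1 : t * w₂⁻¹ ≤ t * w₁⁻¹ := by gcongr
  have h2 := measure_joint_sub_eq (P := P) hY hY MeasurableSet.univ h1
  simp only [mem_univ, true_and] at h2
  rw [← mul_sub, h2]
  rfl

end Disintegration

/-- Standard-case CEV convergence from a kernel domain-of-attraction
condition (Theorem `thmcevstd`, convergence part). -/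
theorem stmt0
    {Ω : Type*} [MeasurableSpace Ω] (P : Measure Ω) [IsProbabilityMeasure P]
    (X Y : Ω → ℝ) (hX : Measurable X) (hY : Measurable Y)
    (hX0 : ∀ᵐ ω ∂P, 0 ≤ X ω) (hY0 : ∀ᵐ ω ∂P, 0 ≤ Y ω)
    (K : Kernel ℝ ℝ) [IsMarkovKernel K]
    (hKver : ∀ A B : Set ℝ, MeasurableSet A → MeasurableSet B →
      P {ω | X ω ∈ A ∧ Y ω ∈ B} = ∫⁻ y in B, K y A ∂(P.map Y))
    (hYtail : ∀ y : ℝ, 0 < y →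
      Tendsto (fun t : ℝ => t * (P {ω | t * y < Y ω}).toReal) atTop (nhds (1 / y)))
    (G : Measure ℝ) [IsProbabilityMeasure G] (hG : G (Set.Ici (0:ℝ)) = 1)
    (hKconv : ∀ x : ℝ, 0 < x →
      ContinuousAt (fun x' : ℝ => (G (Set.Icc 0 x')).toReal) x →
      Tendsto (fun t : ℝ => ((K t) (Set.Icc 0 (t * x))).toReal) atTop
        (nhds ((G (Set.Icc 0 x)).toReal))) :
    ∀ x y : ℝ, 0 < x → 0 < y →
      Tendsto (fun t : ℝ => t * (P {ω | X ω ≤ t * x ∧ t * y < Y ω}).toReal) atTop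
        (nhds ((1 / x) * ∫ u in (0:ℝ)..(x / y), (G (Set.Icc 0 u)).toReal)) := by
  intro x y hx hy
  set H : ℝ → ℝ := fun v => (G (Icc 0 (x * v))).toReal with hHdef
  have hH : Monotone H := fun a b hab =>
    monotone_measureReal_Icc G 0 (mul_le_mul_of_nonneg_left hab hx.le)
  have h0 : ∀ u, 0 ≤ H u := fun u => ENNReal.toReal_nonneg
  have h1 : ∀ u, H u ≤ 1 := fun u => measureReal_le_one
  set φ : ℝ → ℝ → ℝ := fun t w =>
    t * (P {ω | X ω ∈ Icc 0 (t * x) ∧ t * w⁻¹ < Y ω}).toReal with hφ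
  have hdiff : ∀ t w₁ w₂, 0 < t → 0 < w₁ → w₁ < w₂ → φ t w₂ - φ t w₁ =
      t * (P {ω | X ω ∈ Icc 0 (t * x) ∧ Y ω ∈ Ioc (t * w₂⁻¹) (t * w₁⁻¹)}).toReal := by
    intro t w₁ w₂ ht hw₁ hw
    have h1 : t * w₂⁻¹ ≤ t * w₁⁻¹ := by gcongr
    rw [← measure_joint_sub_eq hX hY measurableSet_Icc h1, mul_sub]
  have hmul : ∀ {w₁ w₂ : ℝ}, 0 < w₁ → w₁ < w₂ → ∀ a : ℝ, Tendsto
      (fun t : ℝ => a * (t * (P (Y ⁻¹' Ioc (t * w₂⁻¹) (t * w₁⁻¹))).toReal)) atTop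
      (nhds (a * (w₂ - w₁))) := fun hw₁ hw a =>
    (tendsto_mul_measure_preimage_Ioc hY hYtail hw₁ hw).const_mul a
  have hupper : ∀ w, 0 < w → ∀ ε > 0, ∀ᶠ t in atTop,
      φ t w ≤ (∫ v in (0:ℝ)..w, H v) + ε := by
    intro w hw ε hε
    refine eventually_le_intervalIntegral_of_increment_le hH h0 h1 ?_ ?_ hw hε
    · intro w hw ε hε
      have h := hYtail w⁻¹ (inv_pos.2 hw)
      rw [one_div, inv_inv] at h
      filter_upwards [h.eventually (gt_mem_nhds (lt_add_of_pos_right _ hε)),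
        eventually_gt_atTop 0] with t ht htpos
      refine le_trans (mul_le_mul_of_nonneg_left ?_ htpos.le) ht.le
      exact measureReal_mono fun ω hω => hω.2
    · intro w₁ w₂ v hw₁ hw hwv ε hε
      have hd : 0 < w₂ - w₁ := sub_pos.2 hw
      have hδ : 0 < ε / (2 * (w₂ - w₁)) := by positivity
      have hlt : (H v + ε / (2 * (w₂ - w₁))) * (w₂ - w₁) < (w₂ - w₁) * H v + ε := by
        have : ε / (2 * (w₂ - w₁)) * (w₂ - w₁) = ε / 2 := by field_simp
        nlinarith
      filter_upwards [(hmul hw₁ hw _).eventually (gt_mem_nhds hlt), eventually_gt_atTop 0,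
        eventually_forall_kernel_Icc_le hKconv hx (hw₁.trans hw) hwv hδ] with t ht htpos hK
      rw [hdiff t w₁ w₂ htpos hw₁ hw]
      have := mul_le_mul_of_nonneg_left (measure_joint_le_mul_of_kernel_le hY hKver
        measurableSet_Icc (measurableSet_Ioc (b := t * w₁⁻¹)) (add_nonneg (h0 v) hδ.le)
        fun s hs => hK s hs.1) htpos.le
      linarith
  have hlower : ∀ w, 0 < w → ∀ ε > 0, ∀ᶠ t in atTop,
      (∫ v in (0:ℝ)..w, H v) - ε ≤ φ t w := by
    intro w hw ε hε
    refine eventually_intervalIntegral_le_of_le_increment hH h0 h1 ?_ ?_ hw hε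
    · intro w hw
      filter_upwards [eventually_gt_atTop 0] with t ht
      exact mul_nonneg ht.le ENNReal.toReal_nonneg
    · intro w₁ w₂ v hv hvw hw ε hε
      have hw₁ : 0 < w₁ := hv.trans_lt hvw
      have hd : 0 < w₂ - w₁ := sub_pos.2 hw
      have hδ : 0 < ε / (2 * (w₂ - w₁)) := by positivity
      have hlt : (w₂ - w₁) * H v - ε < (H v - ε / (2 * (w₂ - w₁))) * (w₂ - w₁) := by
        have : ε / (2 * (w₂ - w₁)) * (w₂ - w₁) = ε / 2 := by field_simp
        nlinarith
      filter_upwards [(hmul hw₁ hw _).eventually (lt_mem_nhds hlt), eventually_gt_atTop 0,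
        eventually_forall_le_kernel_Icc hKconv hx hv hvw hw hδ] with t ht htpos hK
      rw [hdiff t w₁ w₂ htpos hw₁ hw]
      have := mul_le_mul_of_nonneg_left (mul_le_measure_joint_of_le_kernel hY hKver
        measurableSet_Icc measurableSet_Ioc fun s hs => hK s hs.1 hs.2) htpos.le
      linarith
  have hint : (1 / x) * ∫ u in (0:ℝ)..(x / y), (G (Icc 0 u)).toReal =
      ∫ v in (0:ℝ)..y⁻¹, H v := by
    rw [hHdef, intervalIntegral.integral_comp_mul_left
      (fun u => (G (Icc 0 u)).toReal) hx.ne', mul_zero, smul_eq_mul, one_div, div_eq_mul_inv]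
  rw [hint]
  have hφy : Tendsto (fun t => φ t y⁻¹) atTop (nhds (∫ v in (0:ℝ)..y⁻¹, H v)) := by
    rw [Metric.tendsto_nhds]
    intro ε hε
    filter_upwards [hupper _ (inv_pos.2 hy) (ε / 2) (by positivity),
      hlower _ (inv_pos.2 hy) (ε / 2) (by positivity)] with t h2 h3
    rw [Real.dist_eq, abs_lt]
    constructor <;> linarith
  refine hφy.congr fun t => ?_
  simp only [hφ, inv_inv]
  congr 2
  refine measure_congr ?_
  filter_upwards [hX0] with ω hω
  simp only [eq_iff_iff]
  exact ⟨fun h => ⟨h.1.2, h.2⟩, fun h => ⟨⟨hω, h.1⟩, h.2⟩⟩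
end

section
/- Let Y have the standard Pareto(1) distribution, let ξ be a nonnegative random variable independent of Y with law G, and set X = ξ·Y. Then for all x > 0 and y > 0: P(X ≤ x, Y > y) = (1/x)·∫₀^{min(x, x/y)} G([0,u]) du. -/
open MeasureTheory ProbabilityTheory Filter Set

/-- The reciprocal of a standard Pareto(1) variable is uniform on `(0, 1]`. -/
lemma map_inv_pareto_eq_restrict_volume {Ω : Type*} [MeasurableSpace Ω] (P : Measure Ω)
    [IsProbabilityMeasure P] (Y : Ω → ℝ) (hY : Measurable Y)
    (hPareto : ∀ y : ℝ, 1 ≤ y → P {ω | y < Y ω} = ENNReal.ofReal (1 / y))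
    (hY1 : ∀ᵐ ω ∂P, 1 ≤ Y ω) :
    P.map (fun ω => (Y ω)⁻¹) = volume.restrict (Ioc (0 : ℝ) 1) := by
  have hYinv : Measurable fun ω => (Y ω)⁻¹ := hY.inv
  have : IsProbabilityMeasure (P.map (fun ω => (Y ω)⁻¹)) :=
    Measure.isProbabilityMeasure_map hYinv.aemeasurable
  refine Measure.ext_of_Ici _ _ fun a => ?_
  rw [Measure.map_apply hYinv measurableSet_Ici, Measure.restrict_apply measurableSet_Ici]
  rcases le_or_gt a 0 with ha | ha
  · have h1 : Ici a ∩ Ioc (0 : ℝ) 1 = Ioc 0 1 :=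
      inter_eq_right.2 fun u hu => ha.trans hu.1.le
    have h2 : (fun ω => (Y ω)⁻¹) ⁻¹' Ici a =ᵐ[P] univ := by
      rw [ae_eq_univ]
      refine measure_eq_zero_iff_ae_notMem.2 ?_
      filter_upwards [hY1] with ω hω
      have : 0 ≤ (Y ω)⁻¹ := by positivity
      simpa using ha.trans this
    rw [h1, measure_congr h2]
    simp
  rcases le_or_gt a 1 with ha1 | ha1
  · have h1 : Ici a ∩ Ioc (0 : ℝ) 1 = Icc a 1 := by
      ext u
      simp only [mem_inter_iff, mem_Ici, mem_Ioc, mem_Icc]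
      exact ⟨fun h => ⟨h.1, h.2.2⟩, fun h => ⟨h.1, ha.trans_le h.1, h.2⟩⟩
    have h2 : (fun ω => (Y ω)⁻¹) ⁻¹' Ici a =ᵐ[P] ({ω | a⁻¹ < Y ω}ᶜ : Set Ω) := by
      refine eventuallyEq_set.2 ?_
      filter_upwards [hY1] with ω hω
      simp only [mem_preimage, mem_Ici, mem_compl_iff, mem_ofPred_eq, not_lt]
      exact le_inv_comm₀ ha (by positivity)
    rw [h1, measure_congr h2, prob_compl_eq_one_sub (measurableSet_lt measurable_const hY),
      hPareto _ ((one_le_inv₀ ha).2 ha1), Real.volume_Icc, ENNReal.ofReal_sub _ ha.le]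
    simp
  · have h1 : Ici a ∩ Ioc (0 : ℝ) 1 = ∅ := by
      ext u
      simp only [mem_inter_iff, mem_Ici, mem_Ioc, mem_empty_iff_false, iff_false]
      intro h
      linarith [h.1, h.2.2]
    rw [h1, measure_empty]
    refine measure_eq_zero_iff_ae_notMem.2 ?_
    filter_upwards [hY1] with ω hω
    simpa using (inv_le_one_of_one_le₀ hω).trans_lt ha1

/-- Joint law of `(ξ·Y, Y)` for `Y` standard Pareto(1) and `ξ ≥ 0`
independent of `Y` with law `G` (Example `exspecg`). -/
theorem stmt3 {Ω : Type*} [MeasurableSpace Ω] (P : Measure Ω) [IsProbabilityMeasure P]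
    (Y ξ : Ω → ℝ) (hY : Measurable Y) (hξ : Measurable ξ)
    (hPareto : ∀ y : ℝ, 1 ≤ y → P {ω | y < Y ω} = ENNReal.ofReal (1 / y))
    (hPareto1 : P {ω | 1 ≤ Y ω} = 1)
    (hξ0 : ∀ᵐ ω ∂P, 0 ≤ ξ ω)
    (hIndep : IndepFun ξ Y P)
    (G : Measure ℝ) (hGdef : G = P.map ξ)
    (x y : ℝ) (hx : 0 < x) (hy : 0 < y) :
    (P {ω | ξ ω * Y ω ≤ x ∧ y < Y ω}).toReal =
      (1 / x) * ∫ u in (0:ℝ)..(min x (x / y)), (G (Set.Icc 0 u)).toReal := by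
  have hYinv : Measurable fun ω => (Y ω)⁻¹ := hY.inv
  have hG : IsProbabilityMeasure G := hGdef ▸ Measure.isProbabilityMeasure_map hξ.aemeasurable
  have hY1 : ∀ᵐ ω ∂P, 1 ≤ Y ω :=
    (prob_compl_eq_zero_iff (measurableSet_le measurable_const hY)).2 hPareto1
  have hU := map_inv_pareto_eq_restrict_volume P Y hY hPareto hY1
  have hjoint : P.map (fun ω => (ξ ω, (Y ω)⁻¹)) = G.prod (volume.restrict (Ioc (0 : ℝ) 1)) := by
    rw [← hU, hGdef]
    exact (indepFun_iff_map_prod_eq_prod_map_map hξ.aemeasurable hYinv.aemeasurable).1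
      (hIndep.comp measurable_id measurable_inv)
  let S : Set (ℝ × ℝ) := {p | 0 ≤ p.1 ∧ p.1 ≤ x * p.2 ∧ p.2 < y⁻¹}
  have hS : MeasurableSet S :=
    (measurableSet_le measurable_const measurable_fst).inter
      ((measurableSet_le measurable_fst (measurable_snd.const_mul x)).inter
        (measurableSet_lt measurable_snd measurable_const))
  have hevent : {ω | ξ ω * Y ω ≤ x ∧ y < Y ω} =ᵐ[P] (fun ω => (ξ ω, (Y ω)⁻¹)) ⁻¹' S := by
    refine eventuallyEq_set.2 ?_
    filter_upwards [hY1, hξ0] with ω h1 h0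
    have hpos : 0 < Y ω := by positivity
    simp only [S, mem_ofPred_eq, mem_preimage, h0, true_and, ← div_eq_mul_inv, le_div_iff₀ hpos,
      inv_lt_inv₀ hpos hy]
  have hmono : Monotone fun u : ℝ => G (Icc 0 (x * u)) := fun u v huv =>
    measure_mono (Icc_subset_Icc_right (mul_le_mul_of_nonneg_left huv hx.le))
  have hslice : ∀ u : ℝ, G ((fun t => (t, u)) ⁻¹' S) =
      (Iio y⁻¹).indicator (fun u => G (Icc 0 (x * u))) u := by
    intro u
    by_cases hu : u < y⁻¹
    · rw [indicator_of_mem (mem_Iio.2 hu)]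
      congr 1
      ext t
      simp [S, hu]
    · rw [indicator_of_notMem (by simpa using hu)]
      simp [S, hu]
  have hset : (Iio y⁻¹ ∩ Ioc 0 1 : Set ℝ) =ᵐ[volume] Ioc 0 (min 1 y⁻¹) := by
    rw [← Ioc_inter_Iic, inter_comm]
    exact (ae_eq_refl _).inter Iio_ae_eq_Iic
  rw [measure_congr hevent,
    ← Measure.map_apply (hξ.prodMk hYinv) hS, hjoint, Measure.prod_apply_symm hS]
  simp_rw [hslice]
  rw [lintegral_indicator measurableSet_Iio, Measure.restrict_restrict measurableSet_Iio,
    Measure.restrict_congr_set hset,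
    ← integral_toReal hmono.measurable.aemeasurable (ae_of_all _ fun _ => measure_lt_top _ _),
    ← intervalIntegral.integral_of_le (by positivity),
    intervalIntegral.integral_comp_mul_left (fun u => (G (Icc 0 u)).toReal) hx.ne',
    mul_zero, mul_min_of_nonneg _ _ hx.le, mul_one, smul_eq_mul, one_div, div_eq_mul_inv]
end

section
/- Let Y have the standard Pareto(1) distribution, let ξ be a nonnegative random variable independent of Y with law G, and set X = ξ·Y. Then: (a) for every x > 0, P(X ≤ x) = (1/x)·∫₀^x G([0,u]) du; (b) for every x > 0, t·P(X > t·x) converges as t → ∞ to E[ξ]/x, where E[ξ] = ∫ u dG(u) ∈ [0,∞]; in particular, if E[ξ] = ∞ then t·P(X > t·x) → ∞. -/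
open MeasureTheory ProbabilityTheory Filter Set

/-- Survival function of the product of a nonnegative variable with an independent
standard Pareto(1) variable. -/
theorem measure_lt_mul_pareto {Ω : Type*} [MeasurableSpace Ω] (P : Measure Ω)
    [IsProbabilityMeasure P] {Y ξ : Ω → ℝ} (hY : Measurable Y) (hξ : Measurable ξ)
    (hPareto : ∀ y : ℝ, 1 ≤ y → P {ω | y < Y ω} = ENNReal.ofReal (1 / y))
    (hPareto1 : P {ω | 1 ≤ Y ω} = 1) (hξ0 : ∀ᵐ ω ∂P, 0 ≤ ξ ω) (hIndep : IndepFun ξ Y P)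
    {s : ℝ} (hs : 0 < s) :
    P {ω | s < ξ ω * Y ω} = ∫⁻ u, ENNReal.ofReal (min (u / s) 1) ∂(P.map ξ) := by
  have hS : MeasurableSet {p : ℝ × ℝ | s < p.1 * p.2} :=
    measurableSet_lt measurable_const (measurable_fst.mul measurable_snd)
  have := Measure.isProbabilityMeasure_map (μ := P) hY.aemeasurable
  have hprod := (indepFun_iff_map_prod_eq_prod_map_map hξ.aemeasurable hY.aemeasurable).1 hIndep
  have h1 : P {ω | s < ξ ω * Y ω} = (P.map fun ω => (ξ ω, Y ω)) {p : ℝ × ℝ | s < p.1 * p.2} := by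
    rw [Measure.map_apply (hξ.prodMk hY) hS]
    rfl
  have hξ0' : ∀ᵐ u ∂(P.map ξ), 0 ≤ u :=
    (ae_map_iff hξ.aemeasurable measurableSet_Ici).2 hξ0
  rw [h1, hprod, Measure.prod_apply hS]
  refine lintegral_congr_ae ?_
  filter_upwards [hξ0'] with u hu
  rw [Measure.map_apply hY (measurable_prodMk_left hS)]
  change P {ω | s < u * Y ω} = _
  rcases hu.eq_or_lt with rfl | hu
  · simp [hs.not_gt]
  have hset : {ω | s < u * Y ω} = {ω | s / u < Y ω} := by
    ext ω
    simp only [mem_ofPred_eq, div_lt_iff₀' hu]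
  rw [hset]
  rcases le_or_gt 1 (s / u) with h | h
  · rw [hPareto _ h, one_div_div, min_eq_left]
    rw [div_le_one hs]
    exact (one_le_div hu).1 h
  · rw [min_eq_right ((one_le_div hs).2 ((div_lt_one hu).1 h).le), ENNReal.ofReal_one]
    refine le_antisymm prob_le_one ?_
    rw [← hPareto1]
    exact measure_mono fun ω hω => h.trans_le hω

/-- Integrating the distribution function of a law on `[0, ∞)`. -/
theorem integral_measure_Icc_eq_integral_max {G : Measure ℝ} [IsProbabilityMeasure G]
    (hG : ∀ᵐ u ∂G, 0 ≤ u) {x : ℝ} (hx : 0 ≤ x) :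
    ∫ u in (0 : ℝ)..x, G.real (Icc 0 u) = ∫ u, max (x - u) 0 ∂G := by
  have hbound : ∀ᵐ u ∂G, max (x - u) 0 ≤ x := by
    filter_upwards [hG] with u hu
    exact max_le (by linarith) hx
  have hint : Integrable (fun u => max (x - u) 0) G := by
    refine Integrable.of_bound (by fun_prop) x ?_
    filter_upwards [hbound] with u hu
    rwa [Real.norm_of_nonneg (le_max_right _ _)]
  rw [hint.integral_eq_integral_Ioc_meas_le (M := x) (ae_of_all _ fun u => le_max_right _ _) hbound]
  have hsub := intervalIntegral.integral_comp_sub_left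
    (a := 0) (b := x) (fun u => G.real (Icc 0 u)) x
  rw [sub_self, sub_zero] at hsub
  rw [← hsub, intervalIntegral.integral_of_le hx]
  refine setIntegral_congr_fun measurableSet_Ioc fun t ht => ?_
  refine measureReal_congr ?_
  filter_upwards [hG] with u hu
  have ht0 : 0 < t := ht.1
  apply propext
  change u ∈ Icc 0 (x - t) ↔ t ≤ max (x - u) 0
  rw [mem_Icc, le_max_iff]
  constructor
  · rintro ⟨-, h⟩
    left
    linarith
  · rintro (h | h)
    · exact ⟨hu, by linarith⟩
    · linarith

/-- Truncated means increase to the mean. -/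
theorem tendsto_lintegral_ofReal_min (G : Measure ℝ) {x : ℝ} (hx : 0 < x) :
    Tendsto (fun t : ℝ => ∫⁻ u, ENNReal.ofReal (min (u / x) t) ∂G) atTop
      (nhds ((∫⁻ u, ENNReal.ofReal u ∂G) / ENNReal.ofReal x)) := by
  have hmono : Monotone fun t : ℝ => ∫⁻ u, ENNReal.ofReal (min (u / x) t) ∂G := fun a b hab =>
    lintegral_mono fun u => ENNReal.ofReal_le_ofReal (min_le_min_left _ hab)
  have hlim : (∫⁻ u, ENNReal.ofReal u ∂G) / ENNReal.ofReal x
      = ∫⁻ u, ENNReal.ofReal (u / x) ∂G := by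
    rw [div_eq_mul_inv, ← lintegral_mul_const _ ENNReal.measurable_ofReal]
    refine lintegral_congr fun u => ?_
    rw [ENNReal.ofReal_div_of_pos hx, div_eq_mul_inv]
  rw [hlim]
  have hsup := tendsto_atTop_iSup hmono
  convert hsup using 2
  refine tendsto_nhds_unique ?_ (hsup.comp (tendsto_natCast_atTop_atTop (R := ℝ)))
  refine lintegral_tendsto_of_tendsto_of_monotone (fun n => by fun_prop)
    (ae_of_all _ fun u a b hab =>
      ENNReal.ofReal_le_ofReal (min_le_min_left _ (Nat.cast_le.2 hab)))
    (ae_of_all _ fun u => ?_)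
  refine tendsto_const_nhds.congr' ?_
  filter_upwards [(tendsto_natCast_atTop_atTop (R := ℝ)).eventually_ge_atTop (u / x)] with n hn
  rw [min_eq_left hn]

/-- Marginal distribution and tail behaviour of `X = ξ·Y` for `Y`
standard Pareto(1) and `ξ ≥ 0` independent with law `G` (Example `exspecg`):
(a) `P(X ≤ x) = (1/x)·∫₀ˣ G([0,u]) du`;
(b) `t·P(X > t·x) → E[ξ]/x` in `[0,∞]`. -/
theorem stmt4 {Ω : Type*} [MeasurableSpace Ω] (P : Measure Ω) [IsProbabilityMeasure P]
    (Y ξ : Ω → ℝ) (hY : Measurable Y) (hξ : Measurable ξ)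
    (hPareto : ∀ y : ℝ, 1 ≤ y → P {ω | y < Y ω} = ENNReal.ofReal (1 / y))
    (hPareto1 : P {ω | 1 ≤ Y ω} = 1)
    (hξ0 : ∀ᵐ ω ∂P, 0 ≤ ξ ω)
    (hIndep : IndepFun ξ Y P)
    (G : Measure ℝ) (hGdef : G = P.map ξ) :
    (∀ x : ℝ, 0 < x →
      (P {ω | ξ ω * Y ω ≤ x}).toReal =
        (1 / x) * ∫ u in (0:ℝ)..x, (G (Set.Icc 0 u)).toReal) ∧
    (∀ x : ℝ, 0 < x →
      Tendsto (fun t : ℝ => ENNReal.ofReal t * P {ω | t * x < ξ ω * Y ω}) atTop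
        (nhds ((∫⁻ u, ENNReal.ofReal u ∂G) / ENNReal.ofReal x))) := by
  have hprob : IsProbabilityMeasure G :=
    hGdef ▸ Measure.isProbabilityMeasure_map hξ.aemeasurable
  have hG : ∀ᵐ u ∂G, 0 ≤ u := by
    rw [hGdef]
    exact (ae_map_iff hξ.aemeasurable measurableSet_Ici).2 hξ0
  have hsurv : ∀ s : ℝ, 0 < s →
      P {ω | s < ξ ω * Y ω} = ∫⁻ u, ENNReal.ofReal (min (u / s) 1) ∂G := fun s hs => by
    rw [hGdef]
    exact measure_lt_mul_pareto P hY hξ hPareto hPareto1 hξ0 hIndep hs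
  refine ⟨fun x hx => ?_, fun x hx => ?_⟩
  · have hnonneg : ∀ᵐ u ∂G, 0 ≤ min (u / x) 1 := by
      filter_upwards [hG] with u hu
      exact le_min (div_nonneg hu hx.le) zero_le_one
    have hint : Integrable (fun u => min (u / x) 1) G := by
      refine Integrable.of_bound (by fun_prop) 1 ?_
      filter_upwards [hnonneg] with u hu
      rw [Real.norm_of_nonneg hu]
      exact min_le_right _ _
    have hsurvReal : P.real {ω | x < ξ ω * Y ω} = ∫ u, min (u / x) 1 ∂G := by
      rw [measureReal_def, hsurv x hx,
        integral_eq_lintegral_of_nonneg_ae hnonneg hint.aestronglyMeasurable]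
    have hcompl : {ω | ξ ω * Y ω ≤ x} = {ω | x < ξ ω * Y ω}ᶜ := by
      ext ω
      simp
    have hcdf := integral_measure_Icc_eq_integral_max hG hx.le
    simp only [measureReal_def] at hcdf
    rw [hcdf, ← measureReal_def, hcompl,
      probReal_compl_eq_one_sub (measurableSet_lt measurable_const (by fun_prop)), hsurvReal,
      ← integral_const_mul]
    have hone : (1 : ℝ) = ∫ _, (1 : ℝ) ∂G := by simp
    conv_lhs => lhs; rw [hone]
    rw [← integral_sub (integrable_const _) hint]
    refine integral_congr_ae (ae_of_all _ fun u => ?_)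
    change 1 - min (u / x) 1 = 1 / x * max (x - u) 0
    rcases le_total u x with h | h
    · rw [min_eq_left ((div_le_one hx).2 h), max_eq_left (by linarith)]
      field_simp
    · rw [min_eq_right ((one_le_div hx).2 h), max_eq_right (by linarith)]
      simp
  · refine (tendsto_lintegral_ofReal_min G hx).congr' ?_
    filter_upwards [eventually_gt_atTop 0] with t ht
    rw [hsurv _ (mul_pos ht hx), ← lintegral_const_mul _ (by fun_prop)]
    refine lintegral_congr fun u => ?_
    rw [← ENNReal.ofReal_mul ht.le, mul_min_of_nonneg _ _ ht.le, mul_one]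
    congr 2
    field_simp
end

section
/- Let Y have the standard Pareto(1) distribution and let W be a Bernoulli(p) random variable (P(W=1) = p = 1 − P(W=0), p ∈ [0,1]) independent of Y. Set X = W·Y + (1−W)·Y². Then for all x > 0 and y > 0: t·P(X ≤ t·x, Y > t·y) → p·(1/y − 1/x)·1_{x ≥ y} as t → ∞. -/
open MeasureTheory ProbabilityTheory Filter Set

/-- The mass a Pareto(1) variable gives to a half-open interval. -/
theorem pareto_real_preimage_Ioc {Ω : Type*} [MeasurableSpace Ω] {P : Measure Ω}
    [IsFiniteMeasure P] {Y : Ω → ℝ} (hY : Measurable Y)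
    (hPareto : ∀ y : ℝ, 1 ≤ y → P {ω | y < Y ω} = ENNReal.ofReal (1 / y))
    {a b : ℝ} (ha : 1 ≤ a) (hab : a ≤ b) :
    P.real (Y ⁻¹' Ioc a b) = 1 / a - 1 / b := by
  have hreal : ∀ c : ℝ, 1 ≤ c → P.real (Y ⁻¹' Ioi c) = 1 / c := fun c hc => by
    have h : P (Y ⁻¹' Ioi c) = ENNReal.ofReal (1 / c) := hPareto c hc
    rw [measureReal_def, h, ENNReal.toReal_ofReal (by positivity)]
  have hdiff : Y ⁻¹' Ioc a b = Y ⁻¹' Ioi a \ Y ⁻¹' Ioi b := by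
    ext ω
    simp
  rw [hdiff, measureReal_sdiff (preimage_mono (Ioi_subset_Ioi hab)) (hY measurableSet_Ioi),
    hreal a ha, hreal b (ha.trans hab)]

/-- A variable whose masses at `1` and `0` add up to one is almost surely `0` or `1`. -/
theorem ae_eq_one_or_eq_zero {Ω : Type*} [MeasurableSpace Ω] {P : Measure Ω}
    [IsProbabilityMeasure P] {W : Ω → ℝ} (hW : Measurable W) {p : ℝ} (hp : p ∈ Icc (0 : ℝ) 1)
    (hW1 : P {ω | W ω = 1} = ENNReal.ofReal p)
    (hW0 : P {ω | W ω = 0} = ENNReal.ofReal (1 - p)) :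
    ∀ᵐ ω ∂P, W ω = 1 ∨ W ω = 0 := by
  have hm1 : MeasurableSet {ω | W ω = 1} := hW (measurableSet_singleton 1)
  have hm0 : MeasurableSet {ω | W ω = 0} := hW (measurableSet_singleton 0)
  have hdisj : Disjoint {ω | W ω = 1} {ω | W ω = 0} := by
    rw [Set.disjoint_left]
    intro ω h1 h0
    exact one_ne_zero (h1.symm.trans h0)
  have hunion : P ({ω | W ω = 1} ∪ {ω | W ω = 0}) = 1 := by
    rw [measure_union hdisj hm0, hW1, hW0, ← ENNReal.ofReal_add hp.1 (by linarith [hp.2])]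
    simp
  exact (mem_ae_iff_prob_eq_one (hm1.union hm0)).2 hunion

/-- CEV limit for `X = W·Y + (1−W)·Y²` under normalization
`(α(t),β(t)) = (t,0)` (Example `exdefecg`, first part). -/
theorem stmt5 {Ω : Type*} [MeasurableSpace Ω] (P : Measure Ω) [IsProbabilityMeasure P]
    (Y W : Ω → ℝ) (hY : Measurable Y) (hW : Measurable W)
    (hPareto : ∀ y : ℝ, 1 ≤ y → P {ω | y < Y ω} = ENNReal.ofReal (1 / y))
    (hPareto1 : P {ω | 1 ≤ Y ω} = 1)
    (p : ℝ) (hp : p ∈ Set.Icc (0:ℝ) 1)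
    (hW1 : P {ω | W ω = 1} = ENNReal.ofReal p)
    (hW0 : P {ω | W ω = 0} = ENNReal.ofReal (1 - p))
    (hIndep : IndepFun W Y P) :
    ∀ x y : ℝ, 0 < x → 0 < y →
      Tendsto (fun t : ℝ =>
          t * (P {ω | W ω * Y ω + (1 - W ω) * (Y ω) ^ 2 ≤ t * x ∧ t * y < Y ω}).toReal)
        atTop (nhds (p * (1 / y - 1 / x) * (if y ≤ x then 1 else 0))) := by
  intro x y hx hy
  refine tendsto_const_nhds.congr' ?_
  filter_upwards [eventually_ge_atTop (1 / y), eventually_ge_atTop (x / y ^ 2),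
    eventually_gt_atTop 0] with t hty htxy ht
  rw [div_le_iff₀ hy] at hty
  rw [div_le_iff₀ (by positivity)] at htxy
  have hae : {ω | W ω * Y ω + (1 - W ω) * (Y ω) ^ 2 ≤ t * x ∧ t * y < Y ω} =ᵐ[P]
      (W ⁻¹' {1} ∩ Y ⁻¹' Ioc (t * y) (t * x) : Set Ω) := by
    filter_upwards [ae_eq_one_or_eq_zero hW hp hW1 hW0] with ω hω
    apply propext
    change (W ω * Y ω + (1 - W ω) * (Y ω) ^ 2 ≤ t * x ∧ t * y < Y ω) ↔
      (W ω = 1 ∧ t * y < Y ω ∧ Y ω ≤ t * x)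
    rcases hω with h | h
    · simp [h, and_comm]
    · simp only [h, zero_mul, sub_zero, one_mul, zero_add, zero_ne_one, false_and, iff_false,
        not_and, not_lt]
      intro hYx
      by_contra! hYy
      have hsq : (t * y) ^ 2 < (Y ω) ^ 2 := by gcongr
      nlinarith [mul_le_mul_of_nonneg_left htxy ht.le]
  have hprod : P (W ⁻¹' {1} ∩ Y ⁻¹' Ioc (t * y) (t * x)) =
      P {ω | W ω = 1} * P (Y ⁻¹' Ioc (t * y) (t * x)) :=
    hIndep.measure_inter_preimage_eq_mul _ _ (measurableSet_singleton 1) measurableSet_Ioc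
  rw [measure_congr hae, hprod, hW1, ENNReal.toReal_mul, ENNReal.toReal_ofReal hp.1,
    ← measureReal_def]
  split_ifs with hyx
  · rw [pareto_real_preimage_Ioc hY hPareto hty (by gcongr)]
    field_simp
  · rw [Ioc_eq_empty (by simpa [ht] using (not_le.mp hyx).le)]
    simp
end

section
/- Let Y have the standard Pareto(1) distribution and let W be a Bernoulli(p) random variable (P(W=1) = p = 1 − P(W=0), p ∈ [0,1]) independent of Y. Set X = W·Y + (1−W)·Y². Then for all x > 0 and y > 0: t·P(X ≤ t²·x, Y > t·y) → p/y + (1−p)·(1/y − x^{−1/2})·1_{x ≥ y²} as t → ∞. -/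
open MeasureTheory ProbabilityTheory Filter Set

/-- The mass that a Pareto(1) variable gives to `(a, b]`. -/
theorem pareto_measureReal_preimage_Ioc {Ω : Type*} [MeasurableSpace Ω] {P : Measure Ω}
    [IsProbabilityMeasure P] {Y : Ω → ℝ} (hY : Measurable Y)
    (hPareto : ∀ y : ℝ, 1 ≤ y → P {ω | y < Y ω} = ENNReal.ofReal (1 / y))
    {a b : ℝ} (ha : 1 ≤ a) (hab : a ≤ b) :
    P.real (Y ⁻¹' Ioc a b) = 1 / a - 1 / b := by
  have tail : ∀ y : ℝ, 1 ≤ y → P.real (Y ⁻¹' Ioi y) = 1 / y := fun y hy => by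
    have h : P (Y ⁻¹' Ioi y) = ENNReal.ofReal (1 / y) := hPareto y hy
    rw [measureReal_def, h, ENNReal.toReal_ofReal (by positivity)]
  have hdiff : Y ⁻¹' Ioc a b = Y ⁻¹' Ioi a \ Y ⁻¹' Ioi b := by
    ext ω; simp
  rw [hdiff, measureReal_sdiff (preimage_mono (Ioi_subset_Ioi hab)) (hY measurableSet_Ioi),
    tail a ha, tail b (ha.trans hab)]

/-- If `W` is Bernoulli(`p`) and independent of `Y`, the probability that `W * Y + (1 - W) * Y ^ 2`
is at most `s ^ 2` while `Y` exceeds a nonnegative threshold splits according to the value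
of `W`. -/
theorem measureReal_bernoulli_mixture {Ω : Type*} [MeasurableSpace Ω] {P : Measure Ω}
    [IsProbabilityMeasure P] {Y W : Ω → ℝ} (hY : Measurable Y) (hW : Measurable W)
    {p : ℝ} (hp : p ∈ Icc (0 : ℝ) 1)
    (hW1 : P {ω | W ω = 1} = ENNReal.ofReal p)
    (hW0 : P {ω | W ω = 0} = ENNReal.ofReal (1 - p))
    (hIndep : IndepFun W Y P) {s a : ℝ} (hs : 0 ≤ s) (ha : 0 ≤ a) :
    P.real {ω | W ω * Y ω + (1 - W ω) * (Y ω) ^ 2 ≤ s ^ 2 ∧ a < Y ω} =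
      p * P.real (Y ⁻¹' Ioc a (s ^ 2)) + (1 - p) * P.real (Y ⁻¹' Ioc a s) := by
  have h1 : P.real (W ⁻¹' {1}) = p := by
    have h : P (W ⁻¹' {1}) = ENNReal.ofReal p := hW1
    rw [measureReal_def, h, ENNReal.toReal_ofReal hp.1]
  have h0 : P.real (W ⁻¹' {0}) = 1 - p := by
    have h : P (W ⁻¹' {0}) = ENNReal.ofReal (1 - p) := hW0
    rw [measureReal_def, h, ENNReal.toReal_ofReal (by linarith [hp.2])]
  have hm1 : MeasurableSet (W ⁻¹' {1}) := hW (measurableSet_singleton 1)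
  have hm0 : MeasurableSet (W ⁻¹' {0}) := hW (measurableSet_singleton 0)
  have hdisj : Disjoint (W ⁻¹' {1}) (W ⁻¹' {0}) :=
    Disjoint.preimage W (by simp)
  have hvalues : ∀ᵐ ω ∂P, ω ∈ W ⁻¹' {1} ∪ W ⁻¹' {0} := by
    refine (mem_ae_iff_prob_eq_one (hm1.union hm0)).2 ?_
    rw [← ENNReal.toReal_eq_one_iff, ← measureReal_def, measureReal_union hdisj hm0, h1, h0]
    ring
  have hprod : ∀ c u v : ℝ, P.real (W ⁻¹' {c} ∩ Y ⁻¹' Ioc u v) =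
      P.real (W ⁻¹' {c}) * P.real (Y ⁻¹' Ioc u v) := fun c u v => by
    simp only [measureReal_def]
    rw [hIndep.measure_inter_preimage_eq_mul _ _ (measurableSet_singleton c) measurableSet_Ioc,
      ENNReal.toReal_mul]
  have hsplit : {ω | W ω * Y ω + (1 - W ω) * (Y ω) ^ 2 ≤ s ^ 2 ∧ a < Y ω} =ᵐ[P]
      (W ⁻¹' {1} ∩ Y ⁻¹' Ioc a (s ^ 2) ∪ W ⁻¹' {0} ∩ Y ⁻¹' Ioc a s : Set Ω) := by
    filter_upwards [hvalues] with ω hω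
    apply propext
    change (W ω * Y ω + (1 - W ω) * (Y ω) ^ 2 ≤ s ^ 2 ∧ a < Y ω) ↔
      (W ω = 1 ∧ a < Y ω ∧ Y ω ≤ s ^ 2) ∨ (W ω = 0 ∧ a < Y ω ∧ Y ω ≤ s)
    rcases hω with h | h
    · have h : W ω = 1 := h
      simp [h, and_comm]
    · have h : W ω = 0 := h
      simp only [h, zero_mul, zero_add, sub_zero, one_mul, zero_ne_one, false_and, true_and,
        false_or]
      rw [and_comm]
      exact and_congr_right fun hY => pow_le_pow_iff_left₀ (ha.trans hY.le) hs two_ne_zero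
  rw [measureReal_congr hsplit, measureReal_union
    (hdisj.mono inter_subset_left inter_subset_left) (hm0.inter (hY measurableSet_Ioc)),
    hprod, hprod, h1, h0]

/-- CEV limit for `X = W·Y + (1−W)·Y²` under normalization
`(α(t),β(t)) = (t²,0)` (Example `exdefecg`, second part). -/
theorem stmt6 {Ω : Type*} [MeasurableSpace Ω] (P : Measure Ω) [IsProbabilityMeasure P]
    (Y W : Ω → ℝ) (hY : Measurable Y) (hW : Measurable W)
    (hPareto : ∀ y : ℝ, 1 ≤ y → P {ω | y < Y ω} = ENNReal.ofReal (1 / y))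
    (hPareto1 : P {ω | 1 ≤ Y ω} = 1)
    (p : ℝ) (hp : p ∈ Set.Icc (0:ℝ) 1)
    (hW1 : P {ω | W ω = 1} = ENNReal.ofReal p)
    (hW0 : P {ω | W ω = 0} = ENNReal.ofReal (1 - p))
    (hIndep : IndepFun W Y P) :
    ∀ x y : ℝ, 0 < x → 0 < y →
      Tendsto (fun t : ℝ =>
          t * (P {ω | W ω * Y ω + (1 - W ω) * (Y ω) ^ 2 ≤ t ^ 2 * x ∧ t * y < Y ω}).toReal)
        atTop
        (nhds (p / y + (1 - p) * (1 / y - x ^ (-(1/2) : ℝ)) * (if y ^ 2 ≤ x then 1 else 0))) := by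
  intro x y hx hy
  set r := √x with hr
  have hr0 : 0 < r := Real.sqrt_pos.2 hx
  have hrx : r ^ 2 = x := Real.sq_sqrt hx.le
  have hpow : x ^ (-(1 / 2) : ℝ) = 1 / r := by
    rw [Real.rpow_neg hx.le, ← Real.sqrt_eq_rpow, one_div]
  have hle : y ^ 2 ≤ x ↔ y ≤ r := by
    rw [← hrx, pow_le_pow_iff_left₀ hy.le hr0.le two_ne_zero]
  have hvanish : Tendsto (fun t : ℝ => p / x * t⁻¹) atTop (nhds 0) := by
    simpa using tendsto_inv_atTop_zero.const_mul (p / x)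
  have hlim := hvanish.const_sub
    (p / y + (1 - p) * (1 / y - 1 / r) * (if y ^ 2 ≤ x then 1 else 0))
  rw [sub_zero] at hlim
  rw [hpow]
  refine hlim.congr' ?_
  filter_upwards [eventually_ge_atTop (1 / y), eventually_ge_atTop (y / x),
    eventually_gt_atTop 0] with t hty htx ht
  have ha : 1 ≤ t * y := (div_le_iff₀ hy).1 hty
  have hab : t * y ≤ (t * r) ^ 2 := by
    have h : y ≤ t * x := (div_le_iff₀ hx).1 htx
    calc t * y ≤ t * (t * x) := by gcongr
      _ = (t * r) ^ 2 := by rw [mul_pow, hrx]; ring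
  have hmix := measureReal_bernoulli_mixture hY hW hp hW1 hW0 hIndep
    (s := t * r) (a := t * y) (by positivity) (by positivity)
  rw [pareto_measureReal_preimage_Ioc hY hPareto ha hab, mul_pow, hrx] at hmix
  rw [← measureReal_def, hmix]
  split_ifs with h
  · rw [pareto_measureReal_preimage_Ioc hY hPareto ha
      (mul_le_mul_of_nonneg_left (hle.1 h) ht.le)]
    field_simp
    ring
  · have hlt : r < y := not_le.1 fun h' => h (hle.2 h')
    rw [Ioc_eq_empty_of_le (mul_le_mul_of_nonneg_left hlt.le ht.le), preimage_empty,
      measureReal_empty]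
    field_simp
    ring
end

section
/- Let Y have the standard Pareto(1) distribution and let Z be a real-valued random variable independent of Y. Set X = max(Y, Z). Then for all x > 0 and y > 0: t·P(X ≤ t·x, Y > t·y) → (1/y − 1/x)·1_{x ≥ y} as t → ∞. -/
open MeasureTheory ProbabilityTheory Filter Set

/-- The distribution function of a real random variable tends to `1` along `t * x`, `x > 0`. -/
lemma tendsto_measureReal_le_mul_atTop {Ω : Type*} [MeasurableSpace Ω] (P : Measure Ω)
    [IsProbabilityMeasure P] {Z : Ω → ℝ} (hZ : Measurable Z) {x : ℝ} (hx : 0 < x) :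
    Tendsto (fun t : ℝ => P.real (Z ⁻¹' Iic (t * x))) atTop (nhds 1) := by
  have : IsProbabilityMeasure (P.map Z) := Measure.isProbabilityMeasure_map hZ.aemeasurable
  refine ((tendsto_cdf_atTop (P.map Z)).comp
    (tendsto_id.atTop_mul_const hx)).congr fun t => ?_
  simp only [Function.comp_apply, id, cdf_eq_real]
  exact map_measureReal_apply hZ measurableSet_Iic

/-- The probability that a standard Pareto variable lies in `(a, b]`. -/
lemma measureReal_preimage_Ioc_of_pareto {Ω : Type*} [MeasurableSpace Ω] (P : Measure Ω)
    [IsProbabilityMeasure P] {Y : Ω → ℝ} (hY : Measurable Y)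
    (hPareto : ∀ y : ℝ, 1 ≤ y → P {ω | y < Y ω} = ENNReal.ofReal (1 / y))
    {a b : ℝ} (ha : 1 ≤ a) (hab : a ≤ b) :
    P.real (Y ⁻¹' Ioc a b) = 1 / a - 1 / b := by
  have tail (c : ℝ) (hc : 1 ≤ c) : P.real (Y ⁻¹' Ioi c) = 1 / c := by
    have h : P (Y ⁻¹' Ioi c) = ENNReal.ofReal (1 / c) := hPareto c hc
    rw [measureReal_def, h, ENNReal.toReal_ofReal (by positivity)]
  rw [← Ioi_sdiff_Ioi, preimage_sdiff,
    measureReal_sdiff (preimage_mono (Ioi_subset_Ioi hab)) (hY measurableSet_Ioi),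
    tail a ha, tail b (ha.trans hab)]

/-- CEV limit for `X = max(Y, Z)` with `Z` independent of the
standard Pareto(1) variable `Y` (Example `exdegen`). -/
theorem stmt7 {Ω : Type*} [MeasurableSpace Ω] (P : Measure Ω) [IsProbabilityMeasure P]
    (Y Z : Ω → ℝ) (hY : Measurable Y) (hZ : Measurable Z)
    (hPareto : ∀ y : ℝ, 1 ≤ y → P {ω | y < Y ω} = ENNReal.ofReal (1 / y))
    (hPareto1 : P {ω | 1 ≤ Y ω} = 1)
    (hIndep : IndepFun Z Y P) :
    ∀ x y : ℝ, 0 < x → 0 < y →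
      Tendsto (fun t : ℝ =>
          t * (P {ω | max (Y ω) (Z ω) ≤ t * x ∧ t * y < Y ω}).toReal)
        atTop (nhds ((1 / y - 1 / x) * (if y ≤ x then 1 else 0))) := by
  intro x y hx hy
  have event (t : ℝ) : {ω | max (Y ω) (Z ω) ≤ t * x ∧ t * y < Y ω} =
      Z ⁻¹' Iic (t * x) ∩ Y ⁻¹' Ioc (t * y) (t * x) := by
    ext ω
    simp only [mem_ofPred_eq, max_le_iff, mem_inter_iff, mem_preimage, mem_Iic, mem_Ioc]
    tauto
  simp only [event]
  split_ifs with hyx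
  · rw [mul_comm, one_mul, ← one_mul (1 / y - 1 / x)]
    refine ((tendsto_measureReal_le_mul_atTop P hZ hx).mul_const (1 / y - 1 / x)).congr' ?_
    filter_upwards [eventually_ge_atTop (1 / y), eventually_gt_atTop 0] with t hty ht
    rw [hIndep.measure_inter_preimage_eq_mul _ _ measurableSet_Iic measurableSet_Ioc,
      ENNReal.toReal_mul, ← measureReal_def, ← measureReal_def,
      measureReal_preimage_Ioc_of_pareto P hY hPareto ((div_le_iff₀ hy).mp hty)
        (mul_le_mul_of_nonneg_left hyx ht.le)]
    field_simp
  · rw [mul_zero]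
    refine tendsto_const_nhds.congr' ?_
    filter_upwards [eventually_ge_atTop 0] with t ht
    rw [Ioc_eq_empty_of_le (mul_le_mul_of_nonneg_left (not_le.mp hyx).le ht)]
    simp
end

section
/- Let Y have the standard Pareto(1) distribution and let W be a Bernoulli(p) random variable (P(W=1) = p = 1 − P(W=0), p ∈ [0,1]) independent of Y. Set X = W·Y + (1−W)·2Y·1_{Y ∉ ℕ} (i.e., X equals Y with probability p, and otherwise equals 2Y unless Y is a positive integer, in which case X = 0). Then for all x > 0 and y > 0: t·P(X ≤ t·x, Y > t·y) → p·(1/y − 1/x)·1_{x ≥ y} + (1−p)·(1/y − 2/x)·1_{x ≥ 2y} as t → ∞. -/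
open MeasureTheory ProbabilityTheory Filter Set
open scoped Classical

/-- A Pareto(1) variable puts mass `1 / a - 1 / b` on the interval `(a, b]`. -/
theorem pareto_measureReal_Ioc {Ω : Type*} [MeasurableSpace Ω] (P : Measure Ω)
    [IsProbabilityMeasure P] (Y : Ω → ℝ) (hY : Measurable Y)
    (hPareto : ∀ y : ℝ, 1 ≤ y → P {ω | y < Y ω} = ENNReal.ofReal (1 / y))
    {a b : ℝ} (ha : 1 ≤ a) (hab : a ≤ b) :
    P.real (Y ⁻¹' Ioc a b) = 1 / a - 1 / b := by
  have htail (c : ℝ) (hc : 1 ≤ c) : P.real (Y ⁻¹' Ioi c) = 1 / c := by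
    have h : P (Y ⁻¹' Ioi c) = ENNReal.ofReal (1 / c) := hPareto c hc
    rw [measureReal_def, h, ENNReal.toReal_ofReal (by positivity)]
  rw [← Ioi_sdiff_Ioi, preimage_sdiff,
    measureReal_sdiff (preimage_mono (Ioi_subset_Ioi hab)) (hY measurableSet_Ioi),
    htail a ha, htail b (ha.trans hab)]

/-- A Pareto(1) variable has no atoms. -/
theorem pareto_ae_ne {Ω : Type*} [MeasurableSpace Ω] (P : Measure Ω)
    [IsProbabilityMeasure P] (Y : Ω → ℝ) (hY : Measurable Y)
    (hPareto : ∀ y : ℝ, 1 ≤ y → P {ω | y < Y ω} = ENNReal.ofReal (1 / y))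
    (c : ℝ) : ∀ᵐ ω ∂P, Y ω ≠ c := by
  rcases le_or_gt c 1 with hc | hc
  · have h : ∀ᵐ ω ∂P, ω ∈ {ω | 1 < Y ω} := by
      exact (mem_ae_iff_prob_eq_one (measurableSet_lt measurable_const hY)).2
        (by simp [hPareto 1 le_rfl])
    filter_upwards [h] with ω hω
    exact (hc.trans_lt hω).ne'
  · have hle : ∀ᶠ s in nhdsWithin c (Iio c), P.real (Y ⁻¹' {c}) ≤ 1 / s - 1 / c := by
      filter_upwards [Ioo_mem_nhdsLT hc] with s hs
      rw [← pareto_measureReal_Ioc P Y hY hPareto hs.1.le hs.2.le]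
      exact measureReal_mono (preimage_mono (singleton_subset_iff.2 ⟨hs.2, le_rfl⟩))
    have hlim : Tendsto (fun s : ℝ => 1 / s - 1 / c) (nhdsWithin c (Iio c)) (nhds 0) := by
      have h : ContinuousAt (fun s : ℝ => 1 / s - 1 / c) c := by
        have : c ≠ 0 := by positivity
        fun_prop (disch := assumption)
      simpa using h.tendsto.mono_left nhdsWithin_le_nhds
    have h0 : P.real (Y ⁻¹' {c}) = 0 := le_antisymm (ge_of_tendsto hlim hle) measureReal_nonneg
    rw [measureReal_eq_zero_iff] at h0
    exact measure_eq_zero_iff_ae_notMem.1 h0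

/-- The Pareto(1) mass of `(t * y, t * z]`, rescaled by `t`, is constant for large `t`. -/
theorem pareto_mul_measureReal_Ioc {Ω : Type*} [MeasurableSpace Ω] (P : Measure Ω)
    [IsProbabilityMeasure P] (Y : Ω → ℝ) (hY : Measurable Y)
    (hPareto : ∀ y : ℝ, 1 ≤ y → P {ω | y < Y ω} = ENNReal.ofReal (1 / y))
    {t y z : ℝ} (ht : 0 < t) (hty : 1 ≤ t * y) :
    t * P.real (Y ⁻¹' Ioc (t * y) (t * z)) = (1 / y - 1 / z) * (if y ≤ z then 1 else 0) := by
  have hy : 0 < y := pos_of_mul_pos_right (one_pos.trans_le hty) ht.le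
  split_ifs with h
  · have hz : 0 < z := hy.trans_le h
    rw [pareto_measureReal_Ioc P Y hY hPareto hty (by gcongr)]
    field_simp
  · rw [Ioc_eq_empty (by simpa [ht] using (not_le.1 h).le)]
    simp

/-- CEV limit for `X = W·Y + (1−W)·2Y·1_{Y ∉ ℕ}` (Example
`exnotconv`): the joint law follows a CEVM even though the normalized kernel
has no unique limit. -/
theorem stmt8 {Ω : Type*} [MeasurableSpace Ω] (P : Measure Ω) [IsProbabilityMeasure P]
    (Y W : Ω → ℝ) (hY : Measurable Y) (hW : Measurable W)
    (hPareto : ∀ y : ℝ, 1 ≤ y → P {ω | y < Y ω} = ENNReal.ofReal (1 / y))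
    (hPareto1 : P {ω | 1 ≤ Y ω} = 1)
    (p : ℝ) (hp : p ∈ Set.Icc (0:ℝ) 1)
    (hW1 : P {ω | W ω = 1} = ENNReal.ofReal p)
    (hW0 : P {ω | W ω = 0} = ENNReal.ofReal (1 - p))
    (hIndep : IndepFun W Y P) :
    ∀ x y : ℝ, 0 < x → 0 < y →
      Tendsto (fun t : ℝ =>
          t * (P {ω | W ω * Y ω +
              (1 - W ω) * (2 * Y ω) * (if ∃ n : ℕ, Y ω = n then 0 else 1) ≤ t * x ∧
              t * y < Y ω}).toReal)
        atTop
        (nhds (p * (1 / y - 1 / x) * (if y ≤ x then 1 else 0) +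
          (1 - p) * (1 / y - 2 / x) * (if 2 * y ≤ x then 1 else 0))) := by
  intro x y hx hy
  have hp1 : P.real (W ⁻¹' {1}) = p := by
    have h : P (W ⁻¹' {1}) = ENNReal.ofReal p := hW1
    rw [measureReal_def, h, ENNReal.toReal_ofReal hp.1]
  have hp0 : P.real (W ⁻¹' {0}) = 1 - p := by
    have h : P (W ⁻¹' {0}) = ENNReal.ofReal (1 - p) := hW0
    rw [measureReal_def, h, ENNReal.toReal_ofReal (sub_nonneg.2 hp.2)]
  have hdisj : Disjoint (W ⁻¹' {1}) (W ⁻¹' {0}) := Disjoint.preimage W (by simp)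
  have hbern : ∀ᵐ ω ∂P, ω ∈ W ⁻¹' {1} ∪ W ⁻¹' {0} := by
    refine (mem_ae_iff_prob_eq_one
      ((hW (measurableSet_singleton 1)).union (hW (measurableSet_singleton 0)))).2 ?_
    rw [← ENNReal.toReal_eq_one_iff, ← measureReal_def,
      measureReal_union hdisj (hW (measurableSet_singleton 0)), hp1, hp0]
    ring
  have hnat : ∀ᵐ ω ∂P, ∀ n : ℕ, Y ω ≠ n :=
    ae_all_iff.2 fun n => pareto_ae_ne P Y hY hPareto n
  have hprod (w : ℝ) (s : Set ℝ) (hs : MeasurableSet s) :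
      P.real (W ⁻¹' {w} ∩ Y ⁻¹' s) = P.real (W ⁻¹' {w}) * P.real (Y ⁻¹' s) := by
    simp only [measureReal_def,
      hIndep.measure_inter_preimage_eq_mul {w} s (measurableSet_singleton w) hs,
      ENNReal.toReal_mul]
  refine tendsto_const_nhds.congr' ?_
  filter_upwards [eventually_ge_atTop (1 / y), eventually_gt_atTop 0] with t hty ht
  have hty' : 1 ≤ t * y := (div_le_iff₀ hy).1 hty
  have hae : {ω | W ω * Y ω +
      (1 - W ω) * (2 * Y ω) * (if ∃ n : ℕ, Y ω = n then 0 else 1) ≤ t * x ∧ t * y < Y ω}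
      =ᵐ[P] (W ⁻¹' {1} ∩ Y ⁻¹' Ioc (t * y) (t * x) ∪
        W ⁻¹' {0} ∩ Y ⁻¹' Ioc (t * y) (t * (x / 2)) : Set Ω) := by
    rw [eventuallyEq_set]
    filter_upwards [hbern, hnat] with ω hω hn
    have hn' : ¬ ∃ n : ℕ, Y ω = n := not_exists.2 hn
    rcases hω with hω | hω <;> rw [mem_preimage, mem_singleton_iff] at hω
    · simp [hω, and_comm]
    · have : 2 * Y ω ≤ t * x ↔ Y ω ≤ t * (x / 2) := by constructor <;> intro h <;> linarith
      simp [hω, hn', this, and_comm]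
  have hx2 : 1 / (x / 2) = 2 / x := by field_simp
  have hiff : y ≤ x / 2 ↔ 2 * y ≤ x := by rw [le_div_iff₀ two_pos, mul_comm]
  have hmass1 := pareto_mul_measureReal_Ioc P Y hY hPareto (z := x) ht hty'
  have hmass0 := pareto_mul_measureReal_Ioc P Y hY hPareto (z := x / 2) ht hty'
  simp only [hx2, hiff] at hmass0
  rw [measure_congr hae, ← measureReal_def,
    measureReal_union (hdisj.mono inter_subset_left inter_subset_left)
      ((hW (measurableSet_singleton 0)).inter (hY measurableSet_Ioc)),
    hprod 1 _ measurableSet_Ioc, hprod 0 _ measurableSet_Ioc, hp1, hp0, mul_assoc p,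
    mul_assoc (1 - p), ← hmass1, ← hmass0]
  ring
end

section
/- Let ρ, k ∈ ℝ with (ρ, k) ≠ (0, 0) and let G : ℝ → [0,1] be nondecreasing and right-continuous with G(x) → 1 as x → ∞. Define F(x, y) = ∫₀^{1/y} G(u^ρ·x + ψ(u)) du for x ∈ ℝ and y > 0. Then: (a) if ρ = 0 (so k ≠ 0), F is jointly continuous on ℝ × (0,∞); (b) if ρ ≠ 0, F is jointly continuous at every point (x, y) with x ≠ −k/ρ; (c) if ρ ≠ 0 and G is continuous on ℝ, then F is jointly continuous on all of ℝ × (0,∞). -/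
open MeasureTheory Filter Set

/-- `ψ(x)`: the ERV limit function with parameters `(ρ, k)`. -/
noncomputable def psi (ρ k x : ℝ) : ℝ :=
  if ρ = 0 then k * Real.log x else k * (x ^ ρ - 1) / ρ

/-- Joint continuity of `(x, y) ↦ ∫₀^{1/y} g x u du` for a bounded integrand that is, for almost
every `u > 0`, continuous in the parameter. -/
theorem continuousAt_integral_zero_one_div (g : ℝ → ℝ → ℝ) (hmeas : ∀ x, Measurable (g x))
    (C : ℝ) (hC : ∀ x u, ‖g x u‖ ≤ C) (x y : ℝ) (hy : 0 < y)
    (hcont : ∀ᵐ u : ℝ, 0 < u → ContinuousAt (fun x => g x u) x) :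
    ContinuousAt (fun p : ℝ × ℝ => ∫ u in (0:ℝ)..(1 / p.2), g p.1 u) (x, y) := by
  have hprim : ContinuousAt
      (fun q : ℝ × ℝ => ∫ u in (0:ℝ)..q.2, (Ioi (0:ℝ)).indicator (g q.1) u) (x, 1 / y) := by
    have hy' : 0 < 1 / y := by positivity
    refine intervalIntegral.continuousAt_parametric_primitive_of_dominated (μ := volume)
      (F := fun x => (Ioi (0:ℝ)).indicator (g x)) (fun _ => C) (-1) (1 / y + 1)
      (fun x => ((hmeas x).indicator measurableSet_Ioi).aestronglyMeasurable)
      (Eventually.of_forall fun x => Eventually.of_forall fun u =>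
        (norm_indicator_le_norm_self _ _).trans (hC x u))
      intervalIntegrable_const (ae_restrict_of_ae ?_) ⟨by norm_num, by linarith⟩
      ⟨by linarith, by linarith⟩ (by simp)
    filter_upwards [hcont] with u hu
    by_cases h : 0 < u
    · simpa [indicator, h] using hu h
    · simpa [indicator, h] using continuousAt_const
  have hmap : ContinuousAt (fun p : ℝ × ℝ => (p.1, 1 / p.2)) (x, y) :=
    continuousAt_fst.prodMk (continuousAt_const.div continuousAt_snd hy.ne')
  refine (hprim.comp_of_eq hmap rfl).congr ?_
  filter_upwards [continuousAt_snd.eventually (lt_mem_nhds (show 0 < (x, y).2 from hy))] with p hp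
  refine intervalIntegral.integral_congr_ae (Eventually.of_forall fun u hu => ?_)
  rw [uIoc_of_le (by positivity)] at hu
  exact indicator_of_mem hu.1 _

theorem measurable_psi (ρ k : ℝ) : Measurable (psi ρ k) := by
  unfold psi
  split_ifs <;> fun_prop

/-- `F` is jointly continuous at `(x, y)` as soon as `G` is continuous at `u^ρ·x + ψ(u)` for
almost every `u > 0`. -/
theorem continuousAt_integral_psi {G : ℝ → ℝ} (hGmono : Monotone G)
    (hGrange : ∀ x : ℝ, G x ∈ Set.Icc (0:ℝ) 1) (ρ k x y : ℝ) (hy : 0 < y)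
    (hG : ∀ᵐ u : ℝ, 0 < u → ContinuousAt G (u ^ ρ * x + psi ρ k u)) :
    ContinuousAt
      (fun p : ℝ × ℝ => ∫ u in (0:ℝ)..(1 / p.2), G (u ^ ρ * p.1 + psi ρ k u)) (x, y) := by
  have hψ := measurable_psi ρ k
  refine continuousAt_integral_zero_one_div (fun x u => G (u ^ ρ * x + psi ρ k u))
    (fun x => hGmono.measurable.comp (by fun_prop)) 1 (fun x u => ?_) x y hy ?_
  · rw [Real.norm_of_nonneg (hGrange _).1]
    exact (hGrange _).2
  · filter_upwards [hG] with u hu h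
    exact ContinuousAt.comp (f := fun x => u ^ ρ * x + psi ρ k u) (hu h) (by fun_prop)

/-- A monotone function is continuous at `h u` for almost every `u > 0` if `h` is injective on
the positive half-line. -/
theorem Monotone.ae_continuousAt_of_injOn {G h : ℝ → ℝ} (hG : Monotone G)
    (hh : InjOn h (Ioi 0)) : ∀ᵐ u : ℝ, 0 < u → ContinuousAt G (h u) := by
  have hcount : {u : ℝ | 0 < u ∧ ¬ContinuousAt G (h u)}.Countable :=
    MapsTo.countable_of_injOn (fun _ hu => hu.2) (hh.mono fun _ hu => hu.1)
      hG.countable_not_continuousAt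
  filter_upwards [hcount.ae_notMem volume] with u hu h0
  by_contra hc
  exact hu ⟨h0, hc⟩

theorem rpow_mul_add_psi_of_ne {ρ : ℝ} (hρ : ρ ≠ 0) (k x u : ℝ) :
    u ^ ρ * x + psi ρ k u = u ^ ρ * (x + k / ρ) - k / ρ := by
  rw [psi, if_neg hρ]
  ring

/-- Joint continuity of the CEV limit distribution function
`F(x,y) = ∫₀^{1/y} G(u^ρ·x + ψ(u)) du` when `(ρ,k) ≠ (0,0)`. -/
theorem stmt12 (ρ k : ℝ) (hρk : ¬(ρ = 0 ∧ k = 0))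
    (G : ℝ → ℝ) (hGmono : Monotone G)
    (hGrc : ∀ x : ℝ, ContinuousWithinAt G (Set.Ici x) x)
    (hGrange : ∀ x : ℝ, G x ∈ Set.Icc (0:ℝ) 1)
    (hGtop : Tendsto G atTop (nhds 1)) :
    (ρ = 0 → ∀ x y : ℝ, 0 < y →
      ContinuousAt
        (fun p : ℝ × ℝ => ∫ u in (0:ℝ)..(1 / p.2), G (u ^ ρ * p.1 + psi ρ k u)) (x, y)) ∧
    (ρ ≠ 0 → ∀ x y : ℝ, 0 < y → x ≠ -k / ρ →
      ContinuousAt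
        (fun p : ℝ × ℝ => ∫ u in (0:ℝ)..(1 / p.2), G (u ^ ρ * p.1 + psi ρ k u)) (x, y)) ∧
    (ρ ≠ 0 → Continuous G → ∀ x y : ℝ, 0 < y →
      ContinuousAt
        (fun p : ℝ × ℝ => ∫ u in (0:ℝ)..(1 / p.2), G (u ^ ρ * p.1 + psi ρ k u)) (x, y)) := by
  refine ⟨?_, ?_, ?_⟩
  · rintro rfl x y hy
    have hk : k ≠ 0 := fun h => hρk ⟨rfl, h⟩
    refine continuousAt_integral_psi hGmono hGrange 0 k x y hy
      (hGmono.ae_continuousAt_of_injOn fun u hu v hv huv => ?_)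
    simp only [psi, if_true, Real.rpow_zero, add_right_inj] at huv
    exact Real.log_injOn_pos hu hv (mul_left_cancel₀ hk huv)
  · intro hρ x y hy hx
    have hx' : x + k / ρ ≠ 0 := fun h => hx (by rw [neg_div]; linarith)
    refine continuousAt_integral_psi hGmono hGrange ρ k x y hy
      (hGmono.ae_continuousAt_of_injOn fun u hu v hv huv => ?_)
    simp only [rpow_mul_add_psi_of_ne hρ, sub_left_inj] at huv
    exact Real.rpow_left_injOn hρ (mem_Ioi.1 hu).le (mem_Ioi.1 hv).le
      (mul_right_cancel₀ hx' huv)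
  · intro _ hGc x y hy
    exact continuousAt_integral_psi hGmono hGrange ρ k x y hy
      (Eventually.of_forall fun _ _ => hGc.continuousAt)
end

section
/- Let (Ω, P) be a probability space, X, Y : Ω → ℝ random variables with Y ≥ 0 almost surely, α : (0,∞) → (0,∞), β : (0,∞) → ℝ, and F : ℝ × (0,∞) → [0,∞) a function that is continuous in its first argument. Assume t·P((X − β(t))/α(t) ≤ x, Y > t·y) → F(x, y) as t → ∞ for every x ∈ ℝ and y > 0. Let f : (0,∞) → ℝ be nondecreasing and right-continuous, and suppose (f(t·s) − β(t))/α(t) → φ(s) as t → ∞ for every s > 0, where φ : (0,∞) → ℝ. Define f^←(v) = inf{s > 0 : f(s) ≥ v} (with inf ∅ = +∞). Then for all x > 0 and y > 0: t·P(f^←(X) ≤ t·x, Y > t·y) → F(φ(x), y) as t → ∞. -/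
open MeasureTheory Filter Set

/-- The generalized inverse `f^←(v) = inf {s > 0 : f(s) ≥ v}`, valued in
`EReal` so that `inf ∅ = +∞`. -/
noncomputable def genInv (f : ℝ → ℝ) (v : ℝ) : EReal :=
  sInf (Real.toEReal '' {s : ℝ | 0 < s ∧ v ≤ f s})

theorem genInv_le_coe_iff {f : ℝ → ℝ} (hf : MonotoneOn f (Ioi 0)) {s : ℝ} (hs : 0 < s)
    (hfs : ContinuousWithinAt f (Ici s) s) (v : ℝ) : genInv f v ≤ (s : EReal) ↔ v ≤ f s := by
  refine ⟨fun h => ?_, fun h => sInf_le ⟨s, ⟨hs, h⟩, rfl⟩⟩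
  refine ge_of_tendsto (hfs.mono_left (nhdsWithin_mono s Ioi_subset_Ici_self)) ?_
  filter_upwards [self_mem_nhdsWithin] with r (hr : s < r)
  obtain ⟨_, ⟨u, ⟨hu, hvu⟩, rfl⟩, hur⟩ :=
    sInf_lt_iff.1 (lt_of_le_of_lt h (EReal.coe_lt_coe_iff.2 hr))
  exact hvu.trans (hf hu (hs.trans hr) (EReal.coe_lt_coe_iff.1 hur).le)

/-- Pointwise convergence of monotone functions can be evaluated along a convergent argument
if the limit is continuous at the limiting argument. -/
theorem tendsto_eval_of_eventually_monotone {ι : Type*} {l : Filter ι} {G : ι → ℝ → ℝ} {g : ℝ → ℝ}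
    {u : ι → ℝ} {c : ℝ} (hG : ∀ᶠ i in l, Monotone (G i))
    (hlim : ∀ x, Tendsto (fun i => G i x) l (nhds (g x))) (hg : ContinuousAt g c)
    (hu : Tendsto u l (nhds c)) : Tendsto (fun i => G i (u i)) l (nhds (g c)) := by
  refine tendsto_order.2 ⟨fun a ha => ?_, fun a ha => ?_⟩
  · obtain ⟨x, hax, hxc⟩ := (((hg.eventually_const_lt ha).filter_mono
      nhdsWithin_le_nhds).and (self_mem_nhdsWithin (s := Iio c))).exists
    filter_upwards [hG, (hlim x).eventually_const_lt hax, hu.eventually_const_lt hxc]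
      with i hi hai hxi
    exact hai.trans_le (hi hxi.le)
  · obtain ⟨x, hax, hxc⟩ := (((hg.eventually_lt_const ha).filter_mono
      nhdsWithin_le_nhds).and (self_mem_nhdsWithin (s := Ioi c))).exists
    filter_upwards [hG, (hlim x).eventually_lt_const hax, hu.eventually_lt_const hxc]
      with i hi hai hxi
    exact (hi hxi.le).trans_lt hai

/-- Standardization of the `X`-variable in a CEV model
(Proposition `propstdfn`, nondecreasing case): if `(f(ts) − β(t))/α(t) → φ(s)`
then `(f^←(X), Y)` satisfies the standardized convergence with limit
`F(φ(x), y)`. -/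
theorem stmt14 {Ω : Type*} [MeasurableSpace Ω] (P : Measure Ω) [IsProbabilityMeasure P]
    (X Y : Ω → ℝ) (hX : Measurable X) (hY : Measurable Y)
    (hY0 : ∀ᵐ ω ∂P, 0 ≤ Y ω)
    (α : ℝ → ℝ) (hα : ∀ t : ℝ, 0 < t → 0 < α t) (β : ℝ → ℝ)
    (F : ℝ → ℝ → ℝ) (hF0 : ∀ x y : ℝ, 0 < y → 0 ≤ F x y)
    (hFcont : ∀ y : ℝ, 0 < y → Continuous (fun x : ℝ => F x y))
    (hconv : ∀ x : ℝ, ∀ y : ℝ, 0 < y →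
      Tendsto (fun t : ℝ => t * (P {ω | (X ω - β t) / α t ≤ x ∧ t * y < Y ω}).toReal)
        atTop (nhds (F x y)))
    (f : ℝ → ℝ) (hf : MonotoneOn f (Set.Ioi 0))
    (hfrc : ∀ s : ℝ, 0 < s → ContinuousWithinAt f (Set.Ici s) s)
    (φ : ℝ → ℝ)
    (hstd : ∀ s : ℝ, 0 < s →
      Tendsto (fun t : ℝ => (f (t * s) - β t) / α t) atTop (nhds (φ s))) :
    ∀ x y : ℝ, 0 < x → 0 < y →
      Tendsto (fun t : ℝ =>
          t * (P {ω | genInv f (X ω) ≤ ((t * x : ℝ) : EReal) ∧ t * y < Y ω}).toReal)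
        atTop (nhds (F (φ x) y)) := by
  intro x y hx hy
  have hmono : ∀ᶠ t : ℝ in atTop, Monotone fun z : ℝ =>
      t * (P {ω | (X ω - β t) / α t ≤ z ∧ t * y < Y ω}).toReal := by
    filter_upwards [eventually_gt_atTop 0] with t ht a b hab
    refine mul_le_mul_of_nonneg_left (ENNReal.toReal_mono (measure_ne_top P _) ?_) ht.le
    exact measure_mono fun ω hω => ⟨hω.1.trans hab, hω.2⟩
  refine (tendsto_eval_of_eventually_monotone hmono (fun z => hconv z y hy)
    (hFcont y hy).continuousAt (hstd x hx)).congr' ?_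
  filter_upwards [eventually_gt_atTop 0] with t ht
  have htx : 0 < t * x := mul_pos ht hx
  simp only [genInv_le_coe_iff hf htx (hfrc _ htx), div_le_div_iff_of_pos_right (hα t ht),
    sub_le_sub_iff_right]
end

section
/- Let ρ, k ∈ ℝ, let α : (0,∞) → (0,∞) and β : (0,∞) → ℝ satisfy α, β ∈ ERV_{ρ,k}, and let f : (0,∞) → ℝ and φ : (0,∞) → ℝ be such that (f(t·x) − β(t))/α(t) → φ(x) as t → ∞ for every x > 0. Then φ(x) = φ(1)·x^ρ + ψ(x) for every x > 0; that is, φ(x) = c·x^ρ + (k/ρ)·(x^ρ − 1) with c = φ(1) when ρ ≠ 0, and φ(x) = c + k·log x when ρ = 0. -/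
open Filter Set

/-- `α, β ∈ ERV_{ρ,k}`: extended regular variation of the normalization pair. -/
def ERV (a b : ℝ → ℝ) (ρ k : ℝ) : Prop :=
  ∀ x : ℝ, 0 < x →
    Filter.Tendsto (fun t : ℝ => a (t * x) / a t) Filter.atTop (nhds (x ^ ρ)) ∧
    Filter.Tendsto (fun t : ℝ => (b (t * x) - b t) / a t) Filter.atTop (nhds (psi ρ k x))

/-- The only possible limit of a standardization function
normalized by an ERV pair is `φ(x) = φ(1)·x^ρ + ψ(x)` (equation
`eqstdfnphi`). -/
theorem stmt15 (ρ k : ℝ) (α β : ℝ → ℝ) (hα : ∀ t : ℝ, 0 < t → 0 < α t)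
    (hERV : ERV α β ρ k) (f φ : ℝ → ℝ)
    (hf : ∀ x : ℝ, 0 < x →
      Tendsto (fun t : ℝ => (f (t * x) - β t) / α t) atTop (nhds (φ x))) :
    ∀ x : ℝ, 0 < x → φ x = φ 1 * x ^ ρ + psi ρ k x := by
  intro x hx
  have hφ : Tendsto (fun t : ℝ => (f (t * x) - β (t * x)) / α (t * x)) atTop (nhds (φ 1)) := by
    simpa [Function.comp_def] using (hf 1 one_pos).comp (tendsto_id.atTop_mul_const hx)
  refine tendsto_nhds_unique (hf x hx)
    (((hφ.mul (hERV x hx).1).add (hERV x hx).2).congr' ?_)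
  filter_upwards [eventually_gt_atTop 0] with t ht
  have hαt := (hα t ht).ne'
  have hαtx := (hα (t * x) (mul_pos ht hx)).ne'
  field_simp
  ring
end

section
/- Let K be a Markov kernel from ℝ to ℝ, α : (0,∞) → (0,∞), β : (0,∞) → ℝ, and let G : ℝ → [0,1] be nondecreasing and right-continuous with G(x) → 1 as x → ∞, such that K(t)((−∞, α(t)·x + β(t)]) → G(x) as t → ∞ for every continuity point x of G. Let f : (0,∞) → ℝ be nondecreasing with (f(t·x) − β(t))/α(t) → φ(x) as t → ∞ for every x > 0, where φ : (0,∞) → ℝ. Then for every x > 0 such that φ(x) is a continuity point of G: K(t)((−∞, f(t·x)]) → G(φ(x)) as t → ∞. -/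
open MeasureTheory ProbabilityTheory Filter Set

/-- Every nonempty open set of reals contains a continuity point of a monotone function. -/
theorem Monotone.dense_continuousAt {G : ℝ → ℝ} (hG : Monotone G) :
    Dense {x | ContinuousAt G x} := by
  simpa [Set.compl_ofPred] using hG.countable_not_continuousAt.dense_compl ℝ

/-- If monotone functions `F t` converge to `G` at its continuity points and `y t → c`, a
continuity point of `G`, then `F t (y t) → G c`. -/
theorem Monotone.tendsto_apply_of_tendsto_continuousAt {ι : Type*} {l : Filter ι}
    {F : ι → ℝ → ℝ} {G : ℝ → ℝ} {y : ι → ℝ} {c : ℝ} (hG : Monotone G)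
    (hF : ∀ᶠ t in l, Monotone (F t))
    (hFG : ∀ x, ContinuousAt G x → Tendsto (fun t => F t x) l (nhds (G x)))
    (hy : Tendsto y l (nhds c)) (hc : ContinuousAt G c) :
    Tendsto (fun t => F t (y t)) l (nhds (G c)) := by
  refine tendsto_order.2 ⟨fun a ha => ?_, fun a ha => ?_⟩
  · obtain ⟨u, huc, hu⟩ := exists_Ioc_subset_of_mem_nhds (hc.eventually_const_lt ha)
      (exists_lt c)
    obtain ⟨z, hz, huz, hzc⟩ := hG.dense_continuousAt.exists_between huc
    filter_upwards [hF, (hFG z hz).eventually_const_lt (hu ⟨huz, hzc.le⟩),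
      hy.eventually_const_lt hzc] with t hmono hat hzt
    exact hat.trans_le (hmono hzt.le)
  · obtain ⟨u, hcu, hu⟩ := exists_Ico_subset_of_mem_nhds (hc.eventually_lt_const ha)
      (exists_gt c)
    obtain ⟨z, hz, hcz, hzu⟩ := hG.dense_continuousAt.exists_between hcu
    filter_upwards [hF, (hFG z hz).eventually_lt_const (hu ⟨hcz.le, hzu⟩),
      hy.eventually_lt_const hcz] with t hmono hat hzt
    exact (hmono hzt.le).trans_lt hat

/-- Standardization through the Markov kernel (Proposition
`propkernstdx`, nondecreasing case): `K(t)((−∞, f(tx)]) → G(φ(x))` at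
continuity points `φ(x)` of `G`. -/
theorem stmt16 (K : Kernel ℝ ℝ) [IsMarkovKernel K]
    (α β : ℝ → ℝ) (hα : ∀ t : ℝ, 0 < t → 0 < α t)
    (G : ℝ → ℝ) (hGmono : Monotone G)
    (hGrc : ∀ x : ℝ, ContinuousWithinAt G (Set.Ici x) x)
    (hGrange : ∀ x : ℝ, G x ∈ Set.Icc (0:ℝ) 1)
    (hGtop : Tendsto G atTop (nhds 1))
    (hK : ∀ x : ℝ, ContinuousAt G x →
      Tendsto (fun t : ℝ => ((K t) (Set.Iic (α t * x + β t))).toReal) atTop (nhds (G x)))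
    (f : ℝ → ℝ) (hf : MonotoneOn f (Set.Ioi 0)) (φ : ℝ → ℝ)
    (hstd : ∀ x : ℝ, 0 < x →
      Tendsto (fun t : ℝ => (f (t * x) - β t) / α t) atTop (nhds (φ x))) :
    ∀ x : ℝ, 0 < x → ContinuousAt G (φ x) →
      Tendsto (fun t : ℝ => ((K t) (Set.Iic (f (t * x)))).toReal) atTop
        (nhds (G (φ x))) := by
  intro x hx hc
  have hmono : ∀ᶠ t in atTop,
      Monotone fun y : ℝ => ((K t) (Set.Iic (α t * y + β t))).toReal := by
    filter_upwards [eventually_gt_atTop 0] with t ht y z hyz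
    have := hα t ht
    exact measureReal_mono (μ := K t) (Set.Iic_subset_Iic.2 (by gcongr))
  refine (hGmono.tendsto_apply_of_tendsto_continuousAt hmono hK (hstd x hx) hc).congr' ?_
  filter_upwards [eventually_gt_atTop 0] with t ht
  rw [mul_div_cancel₀ _ (hα t ht).ne', sub_add_cancel]
end

section
/- Let γ ∈ ℝ and let a : (0,∞) → (0,∞) and b : (0,∞) → ℝ be Lebesgue measurable functions satisfying, for every x > 0, a(t·x)/a(t) → x^γ and (b(t·x) − b(t))/a(t) → (x^γ − 1)/γ (interpreted as log x when γ = 0) as t → ∞. Then there exists a function b* : (0,∞) → ℝ that is continuous and strictly monotone such that (b*(t) − b(t))/a(t) → 0 as t → ∞. -/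
open Filter Set

open MeasureTheory Topology

/-- If `p n` and `q n` tend to `0` pointwise, then for shifts `u n` in `[0, 1]` there are points
`z n` in `[0, 1]` such that both `p n (u n + z n)` and `q n (z n)` tend to `0`. -/
theorem exists_seq_tendsto_zero_translate {p q : ℕ → ℝ → ℝ} {u : ℕ → ℝ}
    (hp : ∀ n, Measurable (p n)) (hq : ∀ n, Measurable (q n))
    (hp0 : ∀ y, Tendsto (fun n => p n y) atTop (𝓝 0))
    (hq0 : ∀ y, Tendsto (fun n => q n y) atTop (𝓝 0))
    (hu : ∀ n, u n ∈ Icc (0 : ℝ) 1) :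
    ∃ z : ℕ → ℝ, (∀ n, z n ∈ Icc (0 : ℝ) 1) ∧
      Tendsto (fun n => p n (u n + z n)) atTop (𝓝 0) ∧
      Tendsto (fun n => q n (z n)) atTop (𝓝 0) := by
  have small : ∀ f : ℕ → ℝ → ℝ, (∀ n, Measurable (f n)) →
      (∀ y, Tendsto (fun n => f n y) atTop (𝓝 0)) → ∀ ε > 0,
      ∀ᶠ n in atTop, volume ({y | ε ≤ |f n y|} ∩ Icc (0 : ℝ) 2) < 1 / 2 := by
    intro f hf hf0 ε hε
    have h := tendstoInMeasure_iff_dist.mp (tendstoInMeasure_of_tendsto_ae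
      (μ := volume.restrict (Icc (0 : ℝ) 2)) (f := f) (g := fun _ => 0)
      (fun n => (hf n).aestronglyMeasurable) (ae_of_all _ hf0)) ε hε
    filter_upwards [h.eventually (gt_mem_nhds (show (0 : ENNReal) < 1 / 2 by simp))] with n hn
    rw [Measure.restrict_apply] at hn
    · simpa [Real.dist_eq] using hn
    · simp only [Real.dist_eq, sub_zero]
      exact measurableSet_le measurable_const (hf n).abs
  have common : ∀ ε > 0, ∀ᶠ n in atTop, ∃ z ∈ Icc (0 : ℝ) 1,
      |p n (u n + z)| < ε ∧ |q n z| < ε := by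
    intro ε hε
    filter_upwards [small p hp hp0 ε hε, small q hq hq0 ε hε] with n h1 h2
    by_contra! hcon
    have hsub : Icc (0 : ℝ) 1 ⊆ (fun z => u n + z) ⁻¹' ({y | ε ≤ |p n y|} ∩ Icc (0 : ℝ) 2) ∪
        ({y | ε ≤ |q n y|} ∩ Icc (0 : ℝ) 2) := by
      intro z hz
      have := hu n
      by_cases h : |p n (u n + z)| < ε
      · exact Or.inr ⟨hcon z hz h, hz.1, by linarith [hz.2]⟩
      · exact Or.inl ⟨not_lt.mp h, by linarith [hz.1, this.1], by linarith [hz.2, this.2]⟩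
    have h3 := (measure_mono (μ := volume) hsub).trans (measure_union_le _ _)
    rw [measure_preimage_add] at h3
    have h4 := h3.trans_lt (ENNReal.add_lt_add h1 h2)
    simp [ENNReal.inv_two_add_inv_two] at h4
  have choice : ∀ n : ℕ, ∃ z ∈ Icc (0 : ℝ) 1, ∀ w ∈ Icc (0 : ℝ) 1,
      |p n (u n + z)| + |q n z| < |p n (u n + w)| + |q n w| + 1 / ((n : ℝ) + 1) := by
    intro n
    set m : ℝ → ℝ := fun z => |p n (u n + z)| + |q n z|
    have hbdd : BddBelow (m '' Icc 0 1) := ⟨0, by rintro _ ⟨z, -, rfl⟩; positivity⟩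
    obtain ⟨_, ⟨z, hz, rfl⟩, hlt⟩ := exists_lt_of_csInf_lt
      ((nonempty_Icc.mpr zero_le_one).image m)
      (lt_add_of_pos_right (sInf (m '' Icc 0 1)) (Nat.one_div_pos_of_nat (α := ℝ) (n := n)))
    exact ⟨z, hz, fun w hw => hlt.trans_le
      (by gcongr; exact csInf_le hbdd (mem_image_of_mem m hw))⟩
  choose z hz hmin using choice
  have hsum : Tendsto (fun n => |p n (u n + z n)| + |q n (z n)|) atTop (𝓝 0) := by
    rw [tendsto_order]
    refine ⟨fun c hc => Eventually.of_forall fun n => hc.trans_le (by positivity),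
      fun ε hε => ?_⟩
    filter_upwards [common (ε / 3) (by positivity),
      tendsto_one_div_add_atTop_nhds_zero_nat.eventually
        (gt_mem_nhds (show (0 : ℝ) < ε / 3 by positivity))] with n ⟨w, hw, h1, h2⟩ h3
    linarith [hmin n w hw]
  refine ⟨z, hz, ?_, ?_⟩ <;> refine squeeze_zero_norm (fun n => ?_) hsum
  · exact le_add_of_nonneg_right (abs_nonneg _)
  · exact le_add_of_nonneg_left (abs_nonneg _)

theorem tendsto_comp_mul_zero {f : ℝ → ℝ} {u h : ℕ → ℝ} (hf : Continuous f)
    (hu : ∀ n, u n ∈ Icc (0 : ℝ) 1) (hh : Tendsto h atTop (𝓝 0)) :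
    Tendsto (fun n => f (u n) * h n) atTop (𝓝 0) := by
  obtain ⟨C, hC⟩ := isCompact_Icc.exists_bound_of_continuousOn
    (hf.continuousOn (s := Icc (0 : ℝ) 1))
  exact bdd_le_mul_tendsto_zero' C (Eventually.of_forall fun n => hC _ (hu n)) hh

/-- Uniform convergence theorem for regularly varying functions, in logarithmic scale and
sequential form. -/
theorem tendsto_log_sub_log_sub_mul {A : ℝ → ℝ} {γ : ℝ} {s u : ℕ → ℝ}
    (hA : Measurable A) (hApos : ∀ s, 0 < A s)
    (hreg : ∀ x, Tendsto (fun s => A (s + x) / A s) atTop (𝓝 (Real.exp (γ * x))))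
    (hs : Tendsto s atTop atTop) (hu : ∀ n, u n ∈ Icc (0 : ℝ) 1) :
    Tendsto (fun n => Real.log (A (s n + u n)) - Real.log (A (s n)) - γ * u n)
      atTop (𝓝 0) := by
  have hlog : ∀ x, Tendsto (fun s => Real.log (A (s + x)) - Real.log (A s) - γ * x)
      atTop (𝓝 0) := by
    intro x
    have h := ((hreg x).log (Real.exp_pos _).ne').sub_const (γ * x)
    simp only [Real.log_exp, sub_self] at h
    refine h.congr fun s => ?_
    rw [Real.log_div (hApos _).ne' (hApos _).ne']
  have hsu : Tendsto (fun n => s n + u n) atTop atTop :=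
    tendsto_atTop_mono (fun n => le_add_of_nonneg_right (hu n).1) hs
  obtain ⟨z, -, h1, h2⟩ := exists_seq_tendsto_zero_translate
    (p := fun n y => Real.log (A (s n + y)) - Real.log (A (s n)) - γ * y)
    (q := fun n y => Real.log (A (s n + u n + y)) - Real.log (A (s n + u n)) - γ * y)
    (fun n => by fun_prop) (fun n => by fun_prop)
    (fun y => (hlog y).comp hs) (fun y => (hlog y).comp hsu) hu
  have h := h1.sub h2
  rw [sub_zero] at h
  refine h.congr fun n => ?_
  rw [add_assoc]
  ring

/-- Uniform convergence theorem for extended regularly varying functions, in logarithmic scale and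
sequential form. -/
theorem tendsto_sub_div_sub {A B Ψ : ℝ → ℝ} {γ : ℝ} {s u : ℕ → ℝ}
    (hA : Measurable A) (hB : Measurable B) (hApos : ∀ s, 0 < A s) (hΨ : Continuous Ψ)
    (hΨadd : ∀ x y, Ψ (x + y) = Ψ x + Real.exp (γ * x) * Ψ y)
    (hreg : ∀ x, Tendsto (fun s => A (s + x) / A s) atTop (𝓝 (Real.exp (γ * x))))
    (hext : ∀ x, Tendsto (fun s => (B (s + x) - B s) / A s) atTop (𝓝 (Ψ x)))
    (hs : Tendsto s atTop atTop) (hu : ∀ n, u n ∈ Icc (0 : ℝ) 1) :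
    Tendsto (fun n => (B (s n + u n) - B (s n)) / A (s n) - Ψ (u n)) atTop (𝓝 0) := by
  have hsu : Tendsto (fun n => s n + u n) atTop atTop :=
    tendsto_atTop_mono (fun n => le_add_of_nonneg_right (hu n).1) hs
  have hext0 : ∀ x, Tendsto (fun s => (B (s + x) - B s) / A s - Ψ x) atTop (𝓝 0) := fun x => by
    simpa using (hext x).sub_const (Ψ x)
  obtain ⟨z, hz, h1, h2⟩ := exists_seq_tendsto_zero_translate
    (p := fun n y => (B (s n + y) - B (s n)) / A (s n) - Ψ y)
    (q := fun n y => (B (s n + u n + y) - B (s n + u n)) / A (s n + u n) - Ψ y)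
    (fun n => by fun_prop) (fun n => by fun_prop)
    (fun y => (hext0 y).comp hs) (fun y => (hext0 y).comp hsu) hu
  have hexp := (tendsto_log_sub_log_sub_mul hA hApos hreg hs hu).rexp
  rw [Real.exp_zero] at hexp
  have hγ : Continuous fun x => Real.exp (γ * x) := by fun_prop
  have h3 := tendsto_comp_mul_zero hγ hu (by simpa using hexp.mul h2)
  have h4 := tendsto_comp_mul_zero hγ hu
    (tendsto_comp_mul_zero hΨ hz (by simpa using hexp.sub_const 1))
  have h := (h1.sub h3).sub h4
  rw [sub_zero, sub_zero] at h
  refine h.congr fun n => ?_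
  have hAn := (hApos (s n)).ne'
  have hAu := (hApos (s n + u n)).ne'
  have hE := (Real.exp_pos (γ * u n)).ne'
  rw [Real.exp_sub, Real.exp_sub, Real.exp_log (hApos _), Real.exp_log (hApos _), hΨadd,
    ← add_assoc]
  field_simp
  ring

/-- Interpolation of a strictly increasing sequence by translates of a fixed profile `φ`. -/
noncomputable def interpolate (c : ℤ → ℝ) (φ : ℝ → ℝ) (s : ℝ) : ℝ :=
  c ⌊s⌋ + (c (⌊s⌋ + 1) - c ⌊s⌋) * φ (Int.fract s)

theorem strictMono_interpolate {c : ℤ → ℝ} {φ : ℝ → ℝ} (hc : StrictMono c) (hφ : StrictMono φ)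
    (h0 : φ 0 = 0) (h1 : φ 1 = 1) : StrictMono (interpolate c φ) := by
  have hstep : ∀ n : ℤ, 0 < c (n + 1) - c n := fun n => sub_pos.mpr (hc (lt_add_one n))
  intro s t hst
  unfold interpolate
  rcases (Int.floor_mono hst.le).eq_or_lt with h | h
  · have : Int.fract s < Int.fract t := by
      simp only [Int.fract, h]
      linarith
    rw [h]
    gcongr
    · exact hstep _
    · exact hφ this
  · have hs : φ (Int.fract s) < 1 := h1 ▸ hφ (Int.fract_lt_one s)
    have ht : 0 ≤ φ (Int.fract t) := h0 ▸ hφ.monotone (Int.fract_nonneg t)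
    have hle : c (⌊s⌋ + 1) ≤ c ⌊t⌋ := hc.monotone h
    nlinarith [hstep ⌊s⌋, mul_nonneg (hstep ⌊t⌋).le ht]

theorem continuous_interpolate {c : ℤ → ℝ} {φ : ℝ → ℝ} (hφ : Continuous φ)
    (h0 : φ 0 = 0) (h1 : φ 1 = 1) : Continuous (interpolate c φ) := by
  have hcell : ∀ n : ℤ, ContinuousOn (interpolate c φ) (Icc (n : ℝ) (n + 1)) := by
    intro n
    have hcont : Continuous fun s : ℝ => c n + (c (n + 1) - c n) * φ (s - n) := by fun_prop
    refine hcont.continuousOn.congr fun s hs => ?_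
    rcases hs.2.eq_or_lt with h | h
    · subst h
      have hfl : ⌊(n : ℝ) + 1⌋ = n + 1 := by simp
      simp [interpolate, h0, h1]
    · have hfl : ⌊s⌋ = n := Int.floor_eq_iff.mpr ⟨hs.1, h⟩
      simp only [interpolate, Int.fract, hfl]
  rw [continuous_iff_continuousAt]
  intro s
  have hleft := hcell (⌊s⌋ - 1)
  push_cast at hleft
  rw [sub_add_cancel] at hleft
  have hunion := hleft.union_of_isClosed (hcell ⌊s⌋) isClosed_Icc isClosed_Icc
  rw [Icc_union_Icc_eq_Icc (by linarith) (by linarith)] at hunion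
  exact hunion.continuousAt
    (Icc_mem_nhds (by linarith [Int.floor_le s]) (Int.lt_floor_add_one s))

theorem exists_strictMono_eventually_eq {B : ℝ → ℝ} (hB : ∀ᶠ s in atTop, B s < B (s + 1)) :
    ∃ c : ℤ → ℝ, StrictMono c ∧ ∀ᶠ n : ℤ in atTop, c n = B n := by
  obtain ⟨M, hM⟩ := eventually_atTop.mp hB
  obtain ⟨N, hN⟩ : ∃ N : ℤ, M ≤ N := ⟨⌈M⌉, Int.le_ceil M⟩
  refine ⟨fun n => if N ≤ n then B n else B N + (n - N), strictMono_int_of_lt_succ fun n => ?_,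
    (eventually_ge_atTop N).mono fun n hn => if_pos hn⟩
  rcases lt_trichotomy (n + 1) N with h | h | h
  · simp [show ¬ N ≤ n by omega, show ¬ N ≤ n + 1 by omega]
  · subst h
    simp
  · have hn : N ≤ n := by omega
    have hn' : (N : ℝ) ≤ n := by exact_mod_cast hn
    simpa [hn, show N ≤ n + 1 by omega] using hM n (hN.trans hn')

theorem psi_exp (γ x : ℝ) :
    psi γ 1 (Real.exp x) = if γ = 0 then x else (Real.exp (γ * x) - 1) / γ := by
  simp [psi, ← Real.exp_mul, mul_comm]

theorem continuous_psi_exp (γ : ℝ) : Continuous fun x => psi γ 1 (Real.exp x) := by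
  simp only [psi_exp]
  split_ifs <;> fun_prop

theorem psi_exp_add (γ x y : ℝ) : psi γ 1 (Real.exp (x + y)) =
    psi γ 1 (Real.exp x) + Real.exp (γ * x) * psi γ 1 (Real.exp y) := by
  simp only [psi_exp]
  split_ifs with h
  · simp [h]
  · rw [mul_add, Real.exp_add]
    field_simp
    ring

theorem strictMono_psi_exp (γ : ℝ) : StrictMono fun x => psi γ 1 (Real.exp x) := by
  intro x y hxy
  simp only [psi_exp]
  split_ifs with h
  · exact hxy
  · rcases lt_or_gt_of_ne h with h | h
    · rw [div_lt_div_right_of_neg h]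
      gcongr ?_ - 1
      exact Real.exp_lt_exp.mpr (mul_lt_mul_of_neg_left hxy h)
    · gcongr

/-- Existence of a continuous, strictly monotone centering
function asymptotically equivalent to `b` (Lemma `lembtnice`). -/
theorem stmt17 (γ : ℝ) (a b : ℝ → ℝ)
    (ha_meas : Measurable a) (hb_meas : Measurable b)
    (hapos : ∀ t : ℝ, 0 < t → 0 < a t)
    (hab : ERV a b γ 1) :
    ∃ bstar : ℝ → ℝ, ContinuousOn bstar (Set.Ioi 0) ∧
      (StrictMonoOn bstar (Set.Ioi 0) ∨ StrictAntiOn bstar (Set.Ioi 0)) ∧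
      Tendsto (fun t : ℝ => (bstar t - b t) / a t) atTop (nhds 0) := by
  set A : ℝ → ℝ := fun s => a (Real.exp s) with hA_def
  set B : ℝ → ℝ := fun s => b (Real.exp s) with hB_def
  set Ψ : ℝ → ℝ := fun x => psi γ 1 (Real.exp x) with hΨ_def
  have hA : Measurable A := ha_meas.comp Real.measurable_exp
  have hB : Measurable B := hb_meas.comp Real.measurable_exp
  have hApos : ∀ s, 0 < A s := fun s => hapos _ (Real.exp_pos s)
  have hreg : ∀ x, Tendsto (fun s => A (s + x) / A s) atTop (𝓝 (Real.exp (γ * x))) := by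
    intro x
    have h := (hab _ (Real.exp_pos x)).1.comp Real.tendsto_exp_atTop
    rw [← Real.exp_mul, mul_comm x] at h
    simpa only [hA_def, Real.exp_add, Function.comp_def] using h
  have hext : ∀ x, Tendsto (fun s => (B (s + x) - B s) / A s) atTop (𝓝 (Ψ x)) := by
    intro x
    have h := (hab _ (Real.exp_pos x)).2.comp Real.tendsto_exp_atTop
    simpa only [hA_def, hB_def, Real.exp_add, Function.comp_def] using h
  have hΨ0 : Ψ 0 = 0 := by simp [hΨ_def, psi]
  have hΨmono : StrictMono Ψ := strictMono_psi_exp γ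
  have hΨcont : Continuous Ψ := continuous_psi_exp γ
  have hΨ1 : 0 < Ψ 1 := hΨ0 ▸ hΨmono one_pos
  have hinc : ∀ᶠ s in atTop, B s < B (s + 1) := by
    filter_upwards [(hext 1).eventually (lt_mem_nhds hΨ1)] with s hs
    exact sub_pos.mp ((div_pos_iff_of_pos_right (hApos s)).mp hs)
  obtain ⟨c, hc, hcB⟩ := exists_strictMono_eventually_eq hinc
  set φ : ℝ → ℝ := fun x => Ψ x / Ψ 1 with hφ_def
  have hφ0 : φ 0 = 0 := by simp [hφ_def, hΨ0]
  have hφ1 : φ 1 = 1 := div_self hΨ1.ne'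
  have hφmono : StrictMono φ := fun x y h => div_lt_div_of_pos_right (hΨmono h) hΨ1
  have hφcont : Continuous φ := hΨcont.div_const _
  refine ⟨fun t => interpolate c φ (Real.log t), ?_, Or.inl ?_, ?_⟩
  · exact (continuous_interpolate hφcont hφ0 hφ1).comp_continuousOn
      (Real.continuousOn_log.mono fun t ht => (mem_Ioi.mp ht).ne')
  · exact (strictMono_interpolate hc hφmono hφ0 hφ1).comp_strictMonoOn Real.strictMonoOn_log
  refine tendsto_of_seq_tendsto fun t ht => ?_
  set n : ℕ → ℤ := fun k => ⌊Real.log (t k)⌋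
  set u : ℕ → ℝ := fun k => Int.fract (Real.log (t k))
  have hn : Tendsto n atTop atTop :=
    tendsto_floor_atTop.comp (Real.tendsto_log_atTop.comp ht)
  have hnR : Tendsto (fun k => (n k : ℝ)) atTop atTop := tendsto_intCast_atTop_atTop.comp hn
  have hu : ∀ k, u k ∈ Icc (0 : ℝ) 1 := fun k => ⟨Int.fract_nonneg _, (Int.fract_lt_one _).le⟩
  have hD := tendsto_sub_div_sub hA hB hApos hΨcont (psi_exp_add γ) hreg hext hnR hu
  have hstep := tendsto_comp_mul_zero hφcont hu
    (h := fun k => (B (n k + 1) - B (n k)) / A (n k) - Ψ 1)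
    (by simpa using ((hext 1).comp hnR).sub_const (Ψ 1))
  have hexp := (tendsto_log_sub_log_sub_mul hA hApos hreg hnR hu).neg.rexp
  rw [neg_zero, Real.exp_zero] at hexp
  have h := tendsto_comp_mul_zero (f := fun x => Real.exp (-(γ * x))) (by fun_prop) hu
    (by simpa using hexp.mul (hstep.sub hD))
  refine h.congr' ?_
  filter_upwards [hn.eventually hcB, hn.eventually ((tendsto_atTop_add_const_right atTop (1 : ℤ)
    tendsto_id).eventually hcB), ht.eventually_gt_atTop 0] with k hk hk1 htk
  have hsum : (n k : ℝ) + u k = Real.log (t k) := Int.floor_add_fract _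
  have hAk : A (n k + u k) = a (t k) := by simp only [hA_def, hsum, Real.exp_log htk]
  have hBk : B (n k + u k) = b (t k) := by simp only [hB_def, hsum, Real.exp_log htk]
  have hI : interpolate c φ (Real.log (t k)) = B (n k) + (B (n k + 1) - B (n k)) * φ (u k) := by
    simp only [id, Int.cast_add, Int.cast_one] at hk1
    rw [← hk, ← hk1]
    rfl
  have hAn := (hApos (n k)).ne'
  have hat := (hapos _ htk).ne'
  have hE := (Real.exp_pos (γ * u k)).ne'
  have hφu : Ψ (u k) = φ (u k) * Ψ 1 := (div_mul_cancel₀ _ hΨ1.ne').symm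
  simp only [Function.comp_apply, hI, hAk, hBk, hφu, Real.exp_neg]
  rw [Real.exp_sub, Real.exp_sub, Real.exp_log (hapos _ htk), Real.exp_log (hApos _)]
  field_simp
  ring
end

section
/- Let γ ∈ ℝ, and let a : (0,∞) → (0,∞) and b : (0,∞) → ℝ satisfy, for every x > 0, a(t·x)/a(t) → x^γ and (b(t·x) − b(t))/a(t) → (x^γ − 1)/γ (interpreted as log x when γ = 0) as t → ∞. Let b* : (0,∞) → ℝ be continuous and strictly increasing with (b*(t) − b(t))/a(t) → 0 as t → ∞. Let K be a Markov kernel from ℝ to ℝ, α : (0,∞) → (0,∞), β : (0,∞) → ℝ, and suppose there is a family of nondecreasing right-continuous functions Φ(s, ·) : ℝ → [0,1], s > 0, such that for every s > 0, every function t ↦ u(t) ∈ (0,∞) with u(t) → s, and every continuity point x of Φ(s, ·): K(b*(t·u(t)))((−∞, α(t)·x + β(t)]) → Φ(s, x) as t → ∞. Then for every u ∈ ℝ with 1 + γ·u > 0, every function t ↦ u(t) ∈ ℝ with u(t) → u, and every continuity point x of Φ((1+γu)^{1/γ}, ·): K(a(t)·u(t) + b(t))((−∞, α(t)·x + β(t)])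 → Φ((1+γu)^{1/γ}, x) as t → ∞, where (1+γu)^{1/γ} is interpreted as e^u when γ = 0. -/
open MeasureTheory ProbabilityTheory Filter Set

theorem strictMonoOn_psi (γ : ℝ) : StrictMonoOn (psi γ 1) (Ioi 0) := by
  intro x hx y hy hxy
  have hx : 0 < x := hx
  have hy : 0 < y := hy
  unfold psi
  split_ifs with h
  · simpa using Real.log_lt_log hx hxy
  · rcases lt_or_gt_of_ne h with h | h
    · have := Real.rpow_lt_rpow_of_neg hx hxy h
      exact (div_lt_div_right_of_neg h).2 (by linarith)
    · have := Real.rpow_lt_rpow hx.le hxy h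
      exact (div_lt_div_iff_of_pos_right h).2 (by linarith)

theorem psi_inverse {γ u : ℝ} (hu : 0 < 1 + γ * u) :
    psi γ 1 (if γ = 0 then Real.exp u else (1 + γ * u) ^ (1 / γ)) = u := by
  unfold psi
  split_ifs with h
  · simp
  · rw [← Real.rpow_mul hu.le, one_div_mul_cancel h, Real.rpow_one]
    field_simp
    ring

/-- An asymptotic centering has the same extended regular variation limit as the original one. -/
theorem ERV.tendsto_of_asymptotic {γ : ℝ} {a b c : ℝ → ℝ} (hapos : ∀ t : ℝ, 0 < t → 0 < a t)
    (hab : ERV a b γ 1) (hc : Tendsto (fun t : ℝ => (c t - b t) / a t) atTop (nhds 0))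
    {x : ℝ} (hx : 0 < x) :
    Tendsto (fun t : ℝ => (c (t * x) - b t) / a t) atTop (nhds (psi γ 1 x)) := by
  have h := ((hc.comp (tendsto_id.atTop_mul_const hx)).mul (hab x hx).1).add (hab x hx).2
  rw [zero_mul, zero_add] at h
  refine h.congr' ?_
  filter_upwards [eventually_gt_atTop 0] with t ht
  have h1 := (hapos t ht).ne'
  have h2 := (hapos (t * x) (mul_pos ht hx)).ne'
  simp only [Function.comp, id]
  field_simp
  ring

/-- If the rescaled continuous increasing functions `c (t * ·)` converge pointwise to a strictly
increasing limit, then solutions `v t` of `c (t * v t) = a t * uf t + b t` exist for large `t` and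
converge to the solution of the limit equation. -/
theorem exists_tendsto_eventually_eq {a b c ψ : ℝ → ℝ} (hapos : ∀ t : ℝ, 0 < t → 0 < a t)
    (hcc : ContinuousOn c (Ioi 0)) (hcm : StrictMonoOn c (Ioi 0)) (hψ : StrictMonoOn ψ (Ioi 0))
    (hlim : ∀ x : ℝ, 0 < x →
      Tendsto (fun t : ℝ => (c (t * x) - b t) / a t) atTop (nhds (ψ x)))
    {s : ℝ} (hs : 0 < s) {uf : ℝ → ℝ} (huf : Tendsto uf atTop (nhds (ψ s))) :
    ∃ v : ℝ → ℝ, (∀ t, 0 < v t) ∧ Tendsto v atTop (nhds s) ∧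
      ∀ᶠ t in atTop, c (t * v t) = a t * uf t + b t := by
  have key : ∀ p q : ℝ, 0 < p → p < s → s < q →
      ∀ᶠ t in atTop, ∃ w ∈ Ioo p q, c (t * w) = a t * uf t + b t := by
    intro p q hp hps hsq
    have hq : 0 < q := hs.trans hsq
    filter_upwards [eventually_gt_atTop 0, (hlim p hp).eventually_lt huf (hψ hp hs hps),
      huf.eventually_lt (hlim q hq) (hψ hs hq hsq)] with t ht h1 h2
    have ha := hapos t ht
    rw [div_lt_iff₀ ha] at h1
    rw [lt_div_iff₀ ha] at h2
    have hcont : ContinuousOn (fun w => c (t * w)) (Icc p q) :=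
      hcc.comp (by fun_prop) fun w hw => mul_pos ht (hp.trans_le hw.1)
    exact intermediate_value_Ioo (hps.trans hsq).le hcont
      ⟨by linarith, by linarith⟩
  classical
  let v : ℝ → ℝ := fun t =>
    if h : ∃ w : ℝ, 0 < w ∧ c (t * w) = a t * uf t + b t then h.choose else s
  have hv : ∀ t, 0 < t → ∀ w, 0 < w → c (t * w) = a t * uf t + b t → v t = w := by
    intro t ht w hw hcw
    have h : ∃ w : ℝ, 0 < w ∧ c (t * w) = a t * uf t + b t := ⟨w, hw, hcw⟩
    have hvt : v t = h.choose := dif_pos h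
    rw [hvt]
    exact mul_left_cancel₀ ht.ne' (hcm.injOn (mul_pos ht h.choose_spec.1) (mul_pos ht hw)
      (h.choose_spec.2.trans hcw.symm))
  refine ⟨v, fun t => ?_, ?_, ?_⟩
  · by_cases h : ∃ w : ℝ, 0 < w ∧ c (t * w) = a t * uf t + b t
    · have hvt : v t = h.choose := dif_pos h
      exact hvt ▸ h.choose_spec.1
    · have hvt : v t = s := dif_neg h
      exact hvt ▸ hs
  · refine tendsto_order.2 ⟨fun p hp => ?_, fun q hq => ?_⟩
    · filter_upwards [eventually_gt_atTop 0, key (max p (s / 2)) (s + 1) (by positivity)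
        (max_lt hp (by linarith)) (by linarith)] with t ht ⟨w, hw, hcw⟩
      rw [hv t ht w ((by positivity : 0 < max p (s / 2)).trans hw.1) hcw]
      exact (le_max_left _ _).trans_lt hw.1
    · filter_upwards [eventually_gt_atTop 0, key (s / 2) q (by positivity)
        (by linarith) hq] with t ht ⟨w, hw, hcw⟩
      rw [hv t ht w ((half_pos hs).trans hw.1) hcw]
      exact hw.2
  · filter_upwards [eventually_gt_atTop 0, key (s / 2) (s + 1) (by positivity)
      (by linarith) (by linarith)] with t ht ⟨w, hw, hcw⟩
    rwa [hv t ht w ((half_pos hs).trans hw.1) hcw]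

/-- Consistency of standardized and direct kernel convergence
(Proposition `propkernunifgeny`): convergence of the standardized kernel
`K(b*(·))` implies convergence of the unstandardized kernel with the changed
argument `(1+γu)^{1/γ}` (interpreted as `e^u` for `γ = 0`). -/
theorem stmt18 (γ : ℝ) (a b : ℝ → ℝ) (hapos : ∀ t : ℝ, 0 < t → 0 < a t)
    (hab : ERV a b γ 1)
    (bstar : ℝ → ℝ) (hbc : ContinuousOn bstar (Set.Ioi 0))
    (hbm : StrictMonoOn bstar (Set.Ioi 0))
    (hbe : Tendsto (fun t : ℝ => (bstar t - b t) / a t) atTop (nhds 0))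
    (K : Kernel ℝ ℝ) [IsMarkovKernel K]
    (α β : ℝ → ℝ) (hα : ∀ t : ℝ, 0 < t → 0 < α t)
    (Φ : ℝ → ℝ → ℝ)
    (hΦmono : ∀ s : ℝ, 0 < s → Monotone (Φ s))
    (hΦrc : ∀ s : ℝ, 0 < s → ∀ x : ℝ, ContinuousWithinAt (Φ s) (Set.Ici x) x)
    (hΦrange : ∀ s : ℝ, 0 < s → ∀ x : ℝ, Φ s x ∈ Set.Icc (0:ℝ) 1)
    (hconv : ∀ s : ℝ, 0 < s → ∀ uf : ℝ → ℝ, (∀ t : ℝ, 0 < uf t) →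
      Tendsto uf atTop (nhds s) →
      ∀ x : ℝ, ContinuousAt (Φ s) x →
        Tendsto (fun t : ℝ => ((K (bstar (t * uf t))) (Set.Iic (α t * x + β t))).toReal)
          atTop (nhds (Φ s x))) :
    ∀ u : ℝ, 0 < 1 + γ * u → ∀ uf : ℝ → ℝ, Tendsto uf atTop (nhds u) →
      ∀ x : ℝ,
        ContinuousAt (Φ (if γ = 0 then Real.exp u else (1 + γ * u) ^ (1 / γ))) x →
        Tendsto (fun t : ℝ => ((K (a t * uf t + b t)) (Set.Iic (α t * x + β t))).toReal)
          atTop (nhds (Φ (if γ = 0 then Real.exp u else (1 + γ * u) ^ (1 / γ)) x)) := by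
  intro u hu uf huf x hx
  have hpsi := psi_inverse hu
  have hs : 0 < if γ = 0 then Real.exp u else (1 + γ * u) ^ (1 / γ) := by
    split_ifs <;> positivity
  generalize (if γ = 0 then Real.exp u else (1 + γ * u) ^ (1 / γ)) = s at *
  obtain ⟨v, hvpos, hvlim, hveq⟩ := exists_tendsto_eventually_eq hapos hbc hbm
    (strictMonoOn_psi γ) (fun y hy => hab.tendsto_of_asymptotic hapos hbe hy) hs
    (by rwa [hpsi] : Tendsto uf atTop (nhds (psi γ 1 s)))
  refine (hconv s hs v hvpos hvlim x hx).congr' ?_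
  filter_upwards [hveq] with t ht
  rw [ht]
end
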